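/- arXiv:2310.17114 — 3 statements merged into one kernel-verified Lean document; each statement's English description precedes it below -/
import Mathlib

section
/- Let p ≥ 1 and let μ be a probability measure on [0,1]^p having a density p_X with respect to Lebesgue measure with 0 < θ̲ ≤ p_X(u) ≤ θ̄ < ∞ for all u ∈ [0,1]^p, where θ̲ ≤ 1 ≤ θ̄; let X ~ μ. Suppose f*(u) = f*_1(u_1) + ⋯ + f*_p(u_p). Fix an integer r ≥ 1 and constants α > 0, β ≥ 1, and suppose that for each k ∈ {1,…,p} there exist knots 0 = t_0^{(k)} < t_1^{(k)} < ⋯ < t_r^{(k)} = 1 with t_j^{(k)} − t_{j−1}^{(k)} ≥ α/r for all j, such that f*_k is differentiable on each open interval (t_{j−1}^{(k)}, t_j^{(k)}), has finite one-sided limits at each knot, and its restriction to each interval (t_{j−1}^{(k)}, t_j^{(k)}) belongs to LRP((t_{j−1}^{(k)}, t_j^{(k)}), β). Then f* satisfies the Sufficient Impurity Decrease condition with parameter λ = θ̲/(p θ̄ τ²), where τ² = max{2rθ̄/θ̲, r²/(2α)} · max{9β², 32 + β²}: for every rectangle A ⊆ [0,1]^p, sup_{j ∈ {1,…,p}, b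 ∈ ℝ} Δ(A, j, b) ≥ λ · P(X ∈ A) · Var(f*(X) | X ∈ A). -/
open MeasureTheory Set Filter
open scoped ENNReal Classical

noncomputable section

def box (p : ℕ) : Set (Fin p → ℝ) := Set.univ.pi fun _ => Set.Icc (0 : ℝ) 1

def condMean {p : ℕ} (μ : Measure (Fin p → ℝ)) (f : (Fin p → ℝ) → ℝ)
    (A : Set (Fin p → ℝ)) : ℝ :=
  (∫ x in A, f x ∂μ) / (μ A).toReal

def condVar {p : ℕ} (μ : Measure (Fin p → ℝ)) (f : (Fin p → ℝ) → ℝ)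
    (A : Set (Fin p → ℝ)) : ℝ :=
  (∫ x in A, (f x - condMean μ f A) ^ 2 ∂μ) / (μ A).toReal

def cellL {p : ℕ} (A : Set (Fin p → ℝ)) (j : Fin p) (b : ℝ) : Set (Fin p → ℝ) :=
  A ∩ {v | v j ≤ b}

def cellR {p : ℕ} (A : Set (Fin p → ℝ)) (j : Fin p) (b : ℝ) : Set (Fin p → ℝ) :=
  A ∩ {v | b < v j}

def impurity {p : ℕ} (μ : Measure (Fin p → ℝ)) (f : (Fin p → ℝ) → ℝ)
    (A : Set (Fin p → ℝ)) (j : Fin p) (b : ℝ) : ℝ :=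
  (μ A).toReal * condVar μ f A
    - (μ (cellL A j b)).toReal * condVar μ f (cellL A j b)
    - (μ (cellR A j b)).toReal * condVar μ f (cellR A j b)

def LRPOn (g g' : ℝ → ℝ) (Q : Set ℝ) (τ : ℝ) : Prop :=
  ∀ a b : ℝ, a < b → Set.Icc a b ⊆ Q →
    (∫ t in a..b, |g' t|) ^ 2 ≤ τ ^ 2 / (b - a) * ⨅ w : ℝ, ∫ t in a..b, |g t - w| ^ 2

lemma sid_step (g : ℝ → ℝ) (a b β : ℝ)
    (hdiff : ∀ s ∈ Ioo a b, DifferentiableAt ℝ g s)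
    (hL : ∀ c d, c < d → Icc c d ⊆ Ioo a b → ∀ w : ℝ,
      (∫ t in c..d, |deriv g t|) ^ 2 ≤ β ^ 2 / (d - c) * ∫ t in c..d, (g t - w) ^ 2)
    (n : ℝ) (hn : 0 ≤ n) (c1 d1 : ℝ) (hsub : Icc c1 d1 ⊆ Ioo a b)
    (K : Set ℝ) (hKc : IsClosed K) (hKsub : K ⊆ Icc c1 d1) (hKne : K.Nonempty)
    (hK : ∀ x ∈ K, ∀ y ∈ Icc c1 d1, |g y - g x| ≤ n * |y - x|)
    (hloc : ∀ u v, u < v → Icc u v ⊆ Icc c1 d1 → Disjoint (Icc u v) K →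
      IntegrableOn (deriv g) (Icc u v)) :
    IntegrableOn (deriv g) (Icc c1 d1) := by
  rw [integrableOn_Icc_iff_integrableOn_Ioo]
  have hKcomp : IsCompact K := isCompact_Icc.of_isClosed_subset hKc hKsub
  refine ⟨(measurable_deriv g).aestronglyMeasurable, ?_⟩
  -- key estimate
  have key : ∀ s ∈ Ioo c1 d1 \ K, ∫⁻ x in Metric.closedBall s (Metric.infDist s K / 2) ∩ Ioo c1 d1,
      ‖deriv g x‖ₑ ≤ ENNReal.ofReal (|β| * (n * (3 / 2 * Metric.infDist s K))) := by
    rintro s ⟨hs, hsK⟩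
    set D := Metric.infDist s K with hD
    have hDpos : 0 < D := (hKc.notMem_iff_infDist_pos hKne).1 hsK
    obtain ⟨z, hzK, hz⟩ := hKcomp.exists_infDist_eq_dist hKne s
    set u := max c1 (s - D / 2) with hu
    set v := min d1 (s + D / 2) with hv
    have hus : u < s := max_lt hs.1 (by linarith)
    have hsv : s < v := lt_min hs.2 (by linarith)
    have huv : u < v := hus.trans hsv
    have hsub' : Icc u v ⊆ Icc c1 d1 := Icc_subset_Icc (le_max_left _ _) (min_le_left _ _)
    have hy : ∀ y ∈ Icc u v, |y - s| ≤ D / 2 := by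
      intro y hy
      have h1 : s - D / 2 ≤ y := (le_max_right _ _).trans hy.1
      have h2 : y ≤ s + D / 2 := hy.2.trans (min_le_right _ _)
      rw [abs_le]; constructor <;> linarith
    have hdisj : Disjoint (Icc u v) K := by
      rw [Set.disjoint_left]
      intro y hyI hyK
      have h1 := hy y hyI
      have h2 : D ≤ dist s y := Metric.infDist_le_dist_of_mem hyK
      rw [dist_comm, Real.dist_eq] at h2
      linarith
    have hint := hloc u v huv hsub' hdisj
    have hb : ∀ y ∈ Icc u v, (g y - g z) ^ 2 ≤ (n * (3 / 2 * D)) ^ 2 := by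
      intro y hyI
      have h1 := hK z hzK y (hsub' hyI)
      have h2 : |y - z| ≤ 3 / 2 * D := by
        have : |y - z| ≤ |y - s| + |s - z| := abs_sub_le _ _ _
        rw [Real.dist_eq] at hz
        have := hy y hyI
        linarith
      rw [← sq_abs]
      gcongr
      exact h1.trans (by gcongr)
    have hcont : ContinuousOn g (Icc u v) := fun y hyI =>
      (hdiff y (hsub (hsub' hyI))).continuousAt.continuousWithinAt
    have h3 : ∫ t in u..v, (g t - g z) ^ 2 ≤ (v - u) * (n * (3 / 2 * D)) ^ 2 := by
      have : ∫ t in u..v, (g t - g z) ^ 2 ≤ ∫ t in u..v, (n * (3 / 2 * D)) ^ 2 := by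
        apply intervalIntegral.integral_mono_on huv.le
        · apply ContinuousOn.intervalIntegrable
          rw [uIcc_of_le huv.le]; fun_prop
        · simp
        · exact hb
      simpa using this
    have h4 : (∫ t in u..v, |deriv g t|) ^ 2 ≤ (|β| * (n * (3 / 2 * D))) ^ 2 := by
      refine (hL u v huv (hsub'.trans hsub) (g z)).trans ?_
      have hvu : 0 < v - u := by linarith
      calc _ ≤ β ^ 2 / (v - u) * ((v - u) * (n * (3 / 2 * D)) ^ 2) := by gcongr
        _ = _ := by rw [mul_pow |β|, sq_abs]; field_simp
    have h5 : (∫ t in u..v, |deriv g t|) ≤ |β| * (n * (3 / 2 * D)) :=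
      le_of_sq_le_sq h4 (by positivity)
    have hss : Metric.closedBall s (D / 2) ∩ Ioo c1 d1 ⊆ Icc u v := by
      rintro y ⟨hy1, hy2⟩
      rw [Metric.mem_closedBall, Real.dist_eq, abs_le] at hy1
      exact ⟨max_le hy2.1.le (by linarith), le_min hy2.2.le (by linarith)⟩
    calc _ ≤ ∫⁻ x in Icc u v, ‖deriv g x‖ₑ := lintegral_mono_set hss
      _ = ENNReal.ofReal (∫ x in Icc u v, ‖deriv g x‖) := by
        rw [ofReal_integral_norm_eq_lintegral_enorm hint]
      _ ≤ _ := by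
        apply ENNReal.ofReal_le_ofReal
        rw [integral_Icc_eq_integral_Ioc, ← intervalIntegral.integral_of_le huv.le]
        exact h5
  obtain ⟨z0, hz0⟩ := hKne
  have hDle : ∀ s ∈ Ioo c1 d1 \ K, Metric.infDist s K ≤ d1 - c1 := by
    rintro s ⟨hs, -⟩
    refine (Metric.infDist_le_dist_of_mem hz0).trans ?_
    have := hKsub hz0
    rw [Real.dist_eq, abs_le]
    constructor <;> linarith [hs.1, hs.2, this.1, this.2]
  obtain ⟨U, hUt, hUd, hUc⟩ := Vitali.exists_disjoint_subfamily_covering_enlargement_closedBall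
    (Ioo c1 d1 \ K) (fun s : ℝ => s) (fun s => Metric.infDist s K / 10) (d1 - c1)
    (fun s hs => by have := hDle s hs; have := Metric.infDist_nonneg (x := s) (s := K); linarith) 5 (by norm_num)
  have hpos : ∀ s ∈ U, 0 < Metric.infDist s K := fun s hs =>
    (hKc.notMem_iff_infDist_pos ⟨z0, hz0⟩).1 (hUt hs).2
  have hUcount : U.Countable := by
    apply Set.PairwiseDisjoint.countable_of_isOpen
      (s := fun s => Metric.ball s (Metric.infDist s K / 10))
    · exact hUd.mono_on (fun s _ => Metric.ball_subset_closedBall)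
    · intro s _; exact Metric.isOpen_ball
    · intro s hs; exact Metric.nonempty_ball.2 (by have := hpos s hs; positivity)
  have hcover : Ioo c1 d1 ⊆ (K ∩ Ioo c1 d1) ∪ ⋃ s ∈ U, (Metric.closedBall s (Metric.infDist s K / 2) ∩ Ioo c1 d1) := by
    intro y hy
    by_cases hyK : y ∈ K
    · exact Or.inl ⟨hyK, hy⟩
    · right
      obtain ⟨s, hsU, hs⟩ := hUc y ⟨hy, hyK⟩
      simp only [mem_iUnion]
      refine ⟨s, hsU, ?_, hy⟩
      have := hs (Metric.mem_closedBall_self (by have := Metric.infDist_nonneg (x := y) (s := K); positivity))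
      convert this using 2
      ring
  have hA : ∫⁻ x in K ∩ Ioo c1 d1, ‖deriv g x‖ₑ < ⊤ := by
    calc _ ≤ ∫⁻ x in K ∩ Ioo c1 d1, ENNReal.ofReal n := by
          apply setLIntegral_mono measurable_const
          rintro x ⟨hxK, hx⟩
          rw [← ofReal_norm]
          apply ENNReal.ofReal_le_ofReal
          apply (hdiff x (hsub (Ioo_subset_Icc_self hx))).hasDerivAt.le_of_lip' hn
          filter_upwards [Ioo_mem_nhds hx.1 hx.2] with y hy
          exact hK x hxK y (Ioo_subset_Icc_self hy)
      _ = ENNReal.ofReal n * volume (K ∩ Ioo c1 d1) := by simp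
      _ < ⊤ := ENNReal.mul_lt_top ENNReal.ofReal_lt_top
          ((measure_mono inter_subset_right).trans_lt measure_Ioo_lt_top)
  have hB : ∫⁻ x in ⋃ s ∈ U, (Metric.closedBall s (Metric.infDist s K / 2) ∩ Ioo c1 d1), ‖deriv g x‖ₑ < ⊤ := by
    have : Countable U := hUcount
    calc _ ≤ ∑' s : U, ∫⁻ x in Metric.closedBall s.1 (Metric.infDist s.1 K / 2) ∩ Ioo c1 d1, ‖deriv g x‖ₑ := by
          rw [biUnion_eq_iUnion]
          exact lintegral_iUnion_le _ _
      _ ≤ ∑' s : U, ENNReal.ofReal (|β| * n * (15 / 2)) * volume (Metric.closedBall s.1 (Metric.infDist s.1 K / 10)) := by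
          apply ENNReal.tsum_le_tsum
          intro s
          refine (key s.1 (hUt s.2)).trans ?_
          rw [Real.volume_closedBall, ← ENNReal.ofReal_mul (by positivity)]
          apply ENNReal.ofReal_le_ofReal
          apply le_of_eq; ring
      _ = ENNReal.ofReal (|β| * n * (15 / 2)) * volume (⋃ s ∈ U, Metric.closedBall s (Metric.infDist s K / 10)) := by
          rw [ENNReal.tsum_mul_left, measure_biUnion hUcount hUd (fun s _ => Metric.isClosed_closedBall.measurableSet)]
      _ ≤ ENNReal.ofReal (|β| * n * (15 / 2)) * volume (Icc (c1 - (d1 - c1)) (d1 + (d1 - c1))) := by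
          gcongr
          apply iUnion₂_subset
          intro s hs y hy
          have h1 := hDle s (hUt hs)
          have h2 := (hUt hs).1
          have h3 := hpos s hs
          rw [Metric.mem_closedBall, Real.dist_eq, abs_le] at hy
          constructor <;> linarith [h2.1, h2.2, hy.1, hy.2]
      _ < ⊤ := ENNReal.mul_lt_top ENNReal.ofReal_lt_top measure_Icc_lt_top
  exact ((lintegral_mono_set hcover).trans (lintegral_union_le _ _ _)).trans_lt (ENNReal.add_lt_top.2 ⟨hA, hB⟩)

lemma sid_locint (g : ℝ → ℝ) (a b β : ℝ)
    (hdiff : ∀ s ∈ Ioo a b, DifferentiableAt ℝ g s)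
    (hL : ∀ c d, c < d → Icc c d ⊆ Ioo a b → ∀ w : ℝ,
      (∫ t in c..d, |deriv g t|) ^ 2 ≤ β ^ 2 / (d - c) * ∫ t in c..d, (g t - w) ^ 2)
    (c d : ℝ) (hcd : Icc c d ⊆ Ioo a b) : IntegrableOn (deriv g) (Icc c d) := by
  set K : Set ℝ := {x ∈ Icc c d | ¬ IntegrableAtFilter (deriv g) (nhdsWithin x (Icc c d))} with hKdef
  have hcont : ContinuousOn g (Icc c d) := fun y hy => (hdiff y (hcd hy)).continuousAt.continuousWithinAt
  have hKc : IsClosed K := by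
    rw [← isOpen_compl_iff, isOpen_iff_mem_nhds]
    intro x hx
    by_cases hxI : x ∈ Icc c d
    · have hx' : IntegrableAtFilter (deriv g) (nhdsWithin x (Icc c d)) := by
        by_contra h; exact hx ⟨hxI, h⟩
      obtain ⟨s, hs, hsi⟩ := hx'
      have := eventually_mem_nhdsWithin_iff.2 hs
      rw [eventually_nhdsWithin_iff] at this
      filter_upwards [this] with y hy hyK
      exact hyK.2 ⟨s, hy hyK.1, hsi⟩
    · filter_upwards [isClosed_Icc.isOpen_compl.mem_nhds hxI] with y hy hyK
      exact hy hyK.1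
  have hKsub : K ⊆ Icc c d := fun x hx => hx.1
  have hKcomp : IsCompact K := isCompact_Icc.of_isClosed_subset hKc hKsub
  rcases K.eq_empty_or_nonempty with hKe | hKne
  · apply LocallyIntegrableOn.integrableOn_isCompact _ isCompact_Icc
    intro x hx
    by_contra h
    have : x ∈ K := ⟨hx, h⟩
    rw [hKe] at this; exact this
  exfalso
  have : CompactSpace K := isCompact_iff_compactSpace.1 hKcomp
  have : Nonempty K := hKne.to_subtype
  let F : ℕ → Set K := fun n => {x | ∀ y ∈ Icc c d, |y - x.1| < 1 / ((n : ℝ) + 1) → |g y - g x.1| ≤ n * |y - x.1|}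
  have hFc : ∀ n, IsClosed (F n) := by
    intro n
    have hgK : Continuous (fun x : K => g x.1) := by
      have := (hcont.mono hKsub)
      exact continuousOn_iff_continuous_domRestrict.1 this
    have : F n = ⋂ y ∈ Icc c d, ({x : K | 1 / ((n : ℝ) + 1) ≤ |y - x.1|} ∪
        {x : K | |g y - g x.1| ≤ n * |y - x.1|}) := by
      ext x
      simp only [F, mem_ofPred_eq, mem_iInter, mem_union]
      refine forall_congr' fun y => forall_congr' fun _ => ?_
      rw [imp_iff_not_or, not_lt]
    rw [this]
    refine isClosed_biInter fun y _ => IsClosed.union ?_ ?_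
    · exact isClosed_le continuous_const (by fun_prop)
    · exact isClosed_le (continuous_const.sub hgK).abs (by fun_prop)
  have hFU : ⋃ n, F n = univ := by
    rw [eq_univ_iff_forall]
    intro x
    obtain ⟨C, hC⟩ := (hdiff x.1 (hcd (hKsub x.2))).isBigO_sub.bound
    obtain ⟨ε, hε, hball⟩ := Metric.eventually_nhds_iff.1 hC
    obtain ⟨n, hn⟩ := exists_nat_ge (max C (1 / ε))
    refine mem_iUnion.2 ⟨n, fun y hy hyx => ?_⟩
    have h1 : 1 / ((n : ℝ) + 1) ≤ ε := by
      rw [div_le_iff₀ (by positivity)]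
      have := (le_max_right _ _).trans hn
      rw [div_le_iff₀ hε] at this
      nlinarith
    have h2 := hball (y := y) (by rw [Real.dist_eq]; linarith)
    rw [Real.norm_eq_abs, Real.norm_eq_abs] at h2
    refine h2.trans ?_
    gcongr
    exact (le_max_left _ _).trans hn
  obtain ⟨n, ⟨x0, hx0⟩⟩ := nonempty_interior_of_iUnion_of_closed hFc hFU
  rw [mem_interior_iff_mem_nhds, Metric.mem_nhds_iff] at hx0
  obtain ⟨ε, hε, hball⟩ := hx0
  have hx0I := hKsub x0.2
  set δ : ℝ := 1 / ((n : ℝ) + 1) with hδ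
  have hδpos : 0 < δ := by positivity
  set ρ := min ε δ / 4 with hρ
  have hρpos : 0 < ρ := by positivity
  have hρε : 4 * ρ ≤ ε := by have := min_le_left ε δ; rw [hρ]; linarith
  have hρδ : 4 * ρ ≤ δ := by have := min_le_right ε δ; rw [hρ]; linarith
  set c1 := max c (x0.1 - ρ) with hc1
  set d1 := min d (x0.1 + ρ) with hd1
  have hJ : Icc c1 d1 ⊆ Icc c d := Icc_subset_Icc (le_max_left _ _) (min_le_left _ _)
  have hJb : ∀ y ∈ Icc c1 d1, x0.1 - ρ ≤ y ∧ y ≤ x0.1 + ρ := fun y hy =>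
    ⟨(le_max_right _ _).trans hy.1, hy.2.trans (min_le_right _ _)⟩
  have hx0J : x0.1 ∈ Icc c1 d1 :=
    ⟨max_le hx0I.1 (by linarith), le_min hx0I.2 (by linarith)⟩
  have hfin : IntegrableOn (deriv g) (Icc c1 d1) := by
    apply sid_step g a b β hdiff hL n (by positivity) c1 d1 (hJ.trans hcd) (K ∩ Icc c1 d1)
      (hKc.inter isClosed_Icc) inter_subset_right ⟨x0.1, x0.2, hx0J⟩
    · rintro x ⟨hxK, hxJ⟩ y hyJ
      have h1 := hJb x hxJ
      have h2 := hJb y hyJ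
      have h3 : (⟨x, hxK⟩ : K) ∈ F n := by
        apply hball
        rw [Metric.mem_ball, Subtype.dist_eq, Real.dist_eq, abs_lt]
        constructor <;> simp only <;> linarith
      refine h3 y (hJ hyJ) ?_
      rw [abs_lt]
      constructor <;> simp only <;> linarith
    · intro u v huv hsub hdis
      apply LocallyIntegrableOn.integrableOn_isCompact _ isCompact_Icc
      intro x hx
      by_contra h
      have hxI := hJ (hsub hx)
      refine Set.disjoint_left.1 hdis hx ⟨⟨hxI, fun h' => h ?_⟩, hsub hx⟩
      exact h'.filter_mono (nhdsWithin_mono _ (hsub.trans hJ))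
  refine x0.2.2 ⟨Icc c1 d1, ?_, hfin⟩
  rw [mem_nhdsWithin]
  refine ⟨Metric.ball x0.1 ρ, Metric.isOpen_ball, Metric.mem_ball_self hρpos, ?_⟩
  rintro y ⟨hy1, hy2⟩
  rw [Metric.mem_ball, Real.dist_eq, abs_lt] at hy1
  exact ⟨max_le hy2.1 (by linarith), le_min hy2.2 (by linarith)⟩

/-- total variation bound on the whole open interval -/
lemma sid_tv (g : ℝ → ℝ) (a b β B : ℝ) (hab : a < b) (hg : Measurable g) (hB : ∀ x, |g x| ≤ B)
    (hdiff : ∀ s ∈ Ioo a b, DifferentiableAt ℝ g s)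
    (hL : ∀ c d, c < d → Icc c d ⊆ Ioo a b → ∀ w : ℝ,
      (∫ t in c..d, |deriv g t|) ^ 2 ≤ β ^ 2 / (d - c) * ∫ t in c..d, (g t - w) ^ 2)
    (w : ℝ) : IntegrableOn (deriv g) (Ioo a b) ∧
      (∫ t in Ioo a b, |deriv g t|) ^ 2 ≤ β ^ 2 / (b - a) * ∫ t in Ioo a b, (g t - w) ^ 2 := by
  set u : ℕ → ℝ := fun n => a + (b - a) / (n + 3) with hu
  set v : ℕ → ℝ := fun n => b - (b - a) / (n + 3) with hv
  have hba : 0 < b - a := by linarith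
  have hlim : Tendsto (fun n : ℕ => (b - a) / ((n : ℝ) + 3)) atTop (nhds 0) := by
    apply Tendsto.div_atTop tendsto_const_nhds
    exact tendsto_atTop_add_const_right _ _ tendsto_natCast_atTop_atTop
  have hulim : Tendsto u atTop (nhds a) := by simpa using tendsto_const_nhds.add hlim
  have hvlim : Tendsto v atTop (nhds b) := by simpa using tendsto_const_nhds.sub hlim
  have hq : ∀ n : ℕ, 0 < (b - a) / ((n : ℝ) + 3) ∧ (b - a) / ((n : ℝ) + 3) ≤ (b - a) / 3 := by
    intro n
    refine ⟨by positivity, ?_⟩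
    gcongr
    have : (0 : ℝ) ≤ n := by positivity
    linarith
  have huv : ∀ n, u n < v n := fun n => by have := hq n; simp only [hu, hv]; linarith
  have hsub : ∀ n, Icc (u n) (v n) ⊆ Ioo a b := fun n y hy => by
    have := hq n
    simp only [hu, hv, mem_Icc] at hy
    constructor <;> linarith [hy.1, hy.2]
  have hint : ∀ n, IntegrableOn (deriv g) (Icc (u n) (v n)) := fun n =>
    sid_locint g a b β hdiff hL _ _ (hsub n)
  have hcov : AECover ((volume : Measure ℝ).restrict (Ioo a b)) atTop fun n => Icc (u n) (v n) :=
    aecover_Ioo_of_Icc hulim hvlim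
  have hres : ∀ n, ((volume : Measure ℝ).restrict (Ioo a b)).restrict (Icc (u n) (v n))
      = volume.restrict (Icc (u n) (v n)) := fun n => by
    rw [Measure.restrict_restrict measurableSet_Icc, inter_eq_left.2 (hsub n)]
  have hconv : ∀ n (F : ℝ → ℝ), ∫ t in u n..v n, F t =
      ∫ t in Icc (u n) (v n), F t ∂(volume.restrict (Ioo a b)) := fun n F => by
    rw [hres, intervalIntegral.integral_of_le (huv n).le, integral_Icc_eq_integral_Ioc]
  have hsqint : IntegrableOn (fun t => (g t - w) ^ 2) (Ioo a b) := by
    refine Integrable.of_bound ?_ ((B + |w|) ^ 2) ?_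
    · exact ((hg.sub_const w).pow_const 2).aestronglyMeasurable
    · refine Eventually.of_forall fun x => ?_
      rw [Real.norm_eq_abs, abs_pow]
      gcongr
      exact (abs_sub _ _).trans (by gcongr; exact hB x)
  set I2 := ∫ t in Ioo a b, (g t - w) ^ 2 with hI2
  have hI2nn : 0 ≤ I2 := integral_nonneg fun _ => sq_nonneg _
  have hineq : ∀ n, (∫ t in Icc (u n) (v n), |deriv g t| ∂(volume.restrict (Ioo a b))) ^ 2 ≤
      β ^ 2 / (v n - u n) * I2 := by
    intro n
    have h1 := hL (u n) (v n) (huv n) (hsub n) w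
    rw [hconv, hconv] at h1
    refine h1.trans ?_
    have : 0 < v n - u n := by have := huv n; linarith
    gcongr
    exact setIntegral_le_integral hsqint (Eventually.of_forall fun _ => sq_nonneg _)
  have hintg : IntegrableOn (deriv g) (Ioo a b) := by
    apply hcov.integrable_of_integral_norm_bounded (√(β ^ 2 / ((b - a) / 3) * I2))
    · intro n; rw [IntegrableOn, hres]; exact hint n
    · refine Eventually.of_forall fun n => ?_
      apply Real.le_sqrt_of_sq_le
      simp only [Real.norm_eq_abs]
      refine (hineq n).trans ?_
      have := hq n
      gcongr
      simp only [hu, hv]; linarith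
  refine ⟨hintg, ?_⟩
  have h1 := (hcov.integral_tendsto_of_countably_generated hintg.abs).pow 2
  have h2 : Tendsto (fun n => β ^ 2 / (v n - u n) * I2) atTop (nhds (β ^ 2 / (b - a) * I2)) :=
    (tendsto_const_nhds.div (hvlim.sub hulim) hba.ne').mul_const _
  exact le_of_tendsto_of_tendsto' h1 h2 hineq

lemma sid_piece {Ω : Type*} [MeasurableSpace Ω] (ν : Measure Ω) [IsFiniteMeasure ν]
    (X : Ω → ℝ) (hX : Measurable X) (Z : Ω → ℝ) (hZ : Integrable Z ν)
    (g : ℝ → ℝ) (a b c H w : ℝ) (hc : c ∈ Ioo a b)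
    (hdiff : ∀ s ∈ Ioo a b, DifferentiableAt ℝ g s)
    (hint : IntegrableOn (deriv g) (Ioo a b))
    (hb0 : ν {ω | X ω = b} = 0)
    (hH : ∀ s ∈ Icc a b, |∫ ω in {ω | X ω ≤ s}, Z ω ∂ν| ≤ H) :
    |∫ ω in X ⁻¹' Ioo a b, (g (X ω) - w) * Z ω ∂ν| ≤
      2 * H * (|g c - w| + ∫ t in Ioo a b, |deriv g t|) := by
  have hab : a < b := hc.1.trans hc.2
  have hH0 : 0 ≤ H := (abs_nonneg _).trans (hH a ⟨le_rfl, hab.le⟩)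
  have hms : ∀ s : ℝ, MeasurableSet {ω | X ω ≤ s} := fun s => measurableSet_le hX measurable_const
  have h1 : ∀ s t, s ≤ t → s ∈ Icc a b → t ∈ Icc a b → |∫ ω in X ⁻¹' Ioc s t, Z ω ∂ν| ≤ 2 * H := by
    intro s t hst hs ht
    have hset : X ⁻¹' Ioc s t = {ω | X ω ≤ t} \ {ω | X ω ≤ s} := by
      ext ω; simp [and_comm]
    have hss : {ω | X ω ≤ s} ⊆ {ω | X ω ≤ t} := fun ω hω => le_trans hω hst
    rw [hset, setIntegral_sdiff (hms s) hZ.integrableOn hss]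
    have h2 := abs_sub (∫ ω in {ω | X ω ≤ t}, Z ω ∂ν) (∫ ω in {ω | X ω ≤ s}, Z ω ∂ν)
    linarith [hH s hs, hH t ht]
  have hIooIoc : ∀ s, (X ⁻¹' Ioo s b : Set Ω) =ᵐ[ν] (X ⁻¹' Ioc s b : Set Ω) := by
    intro s
    have : ∀ᵐ ω ∂ν, X ω ≠ b := by rw [ae_iff]; simpa using hb0
    filter_upwards [this] with ω hω
    apply propext
    change (s < X ω ∧ X ω < b) ↔ (s < X ω ∧ X ω ≤ b)
    exact and_congr_right fun _ => ⟨le_of_lt, fun h => lt_of_le_of_ne h hω⟩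
  have h1' : ∀ s ∈ Icc a b, |∫ ω in X ⁻¹' Ioo s b, Z ω ∂ν| ≤ 2 * H := by
    intro s hs
    rw [setIntegral_congr_set (hIooIoc s)]
    exact h1 s b hs.2 hs ⟨hab.le, le_rfl⟩
  set P : Set Ω := X ⁻¹' Ioo a b with hP
  have hPm : MeasurableSet P := hX measurableSet_Ioo
  let κ : ℝ → ℝ → ℝ := fun x s => (if s < x then 1 else 0) - (if s < c then 1 else 0)
  have hκ : ∀ x s, |κ x s| ≤ 1 := by
    intro x s; simp only [κ]; split_ifs <;> simp
  have hκm : Measurable (Function.uncurry κ) := by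
    apply Measurable.sub
    · exact Measurable.ite (measurableSet_lt measurable_snd measurable_fst) measurable_const measurable_const
    · exact Measurable.ite (measurableSet_lt measurable_snd measurable_const) measurable_const measurable_const
  -- FTC
  have hJ : ∀ x ∈ Ioo a b, ∫ s in Ioo a b, deriv g s * (if s < x then 1 else 0) = ∫ s in a..x, deriv g s := by
    intro x hx
    have : (fun s => deriv g s * (if s < x then (1:ℝ) else 0)) = (Iio x).indicator (deriv g) := by
      ext s; by_cases h : s < x <;> simp [h]
    rw [this, setIntegral_indicator measurableSet_Iio, intervalIntegral.integral_of_le hx.1.le,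
      integral_Ioc_eq_integral_Ioo, Ioo_inter_Iio, min_eq_right hx.2.le]
  have hJi : ∀ x, IntegrableOn (fun s => deriv g s * (if s < x then (1:ℝ) else 0)) (Ioo a b) := by
    intro x
    have : (fun s => deriv g s * (if s < x then (1:ℝ) else 0)) = (Iio x).indicator (deriv g) := by
      ext s; by_cases h : s < x <;> simp [h]
    rw [this]
    exact Integrable.indicator hint measurableSet_Iio
  have hii : ∀ x ∈ Ioo a b, IntervalIntegrable (deriv g) volume a x := by
    intro x hx
    rw [intervalIntegrable_iff_integrableOn_Ioo_of_le hx.1.le]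
    exact hint.mono_set (Ioo_subset_Ioo_right hx.2.le)
  have hftc : ∀ x ∈ Ioo a b, ∫ s in Ioo a b, deriv g s * κ x s = g x - g c := by
    intro x hx
    simp only [κ, mul_sub]
    rw [integral_sub (hJi x) (hJi c), hJ x hx, hJ c hc,
      intervalIntegral.integral_interval_sub_left (hii x hx) (hii c hc)]
    apply intervalIntegral.integral_eq_sub_of_hasDerivAt
    · intro y hy
      exact (hdiff y ((ordConnected_Ioo.uIcc_subset hc hx) hy)).hasDerivAt
    · exact (hii c hc).symm.trans (hii x hx)
  have hprod : Integrable (Function.uncurry fun ω s => Z ω * (deriv g s * κ (X ω) s))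
      ((ν.restrict P).prod (volume.restrict (Ioo a b))) := by
    have h0 : Integrable (fun z : Ω × ℝ => Z z.1 * deriv g z.2) ((ν.restrict P).prod (volume.restrict (Ioo a b))) :=
      (hZ.restrict).mul_prod hint
    have hm : Measurable (fun z : Ω × ℝ => κ (X z.1) z.2) :=
      hκm.comp ((hX.comp measurable_fst).prodMk measurable_snd)
    refine (h0.mul_bdd (c := 1) hm.aestronglyMeasurable (Eventually.of_forall fun z => hκ _ _)).congr ?_
    refine Eventually.of_forall fun z => ?_
    simp [Function.uncurry, mul_assoc]
  have hmain : ∫ ω in P, (g (X ω) - w) * Z ω ∂ν = (g c - w) * ∫ ω in P, Z ω ∂ν +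
      ∫ s in Ioo a b, deriv g s * ∫ ω in P, Z ω * κ (X ω) s ∂ν := by
    have e1 : ∫ ω in P, (g (X ω) - w) * Z ω ∂ν = ∫ ω in P, ((g c - w) * Z ω +
        ∫ s in Ioo a b, Z ω * (deriv g s * κ (X ω) s)) ∂ν := by
      apply setIntegral_congr_fun hPm
      intro ω hω
      simp only
      rw [integral_const_mul, hftc (X ω) hω]
      ring
    have hpl : Integrable (fun ω => ∫ s in Ioo a b, Z ω * (deriv g s * κ (X ω) s)) (ν.restrict P) :=
      hprod.integral_prod_left
    rw [e1, integral_add (hZ.restrict.const_mul _) hpl, integral_const_mul,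
      integral_integral_swap hprod]
    congr 1
    apply integral_congr_ae
    refine Eventually.of_forall fun s => ?_
    simp only
    rw [← integral_const_mul]
    congr 1
    ext ω; ring
  have hin : ∀ s ∈ Ioo a b, |∫ ω in P, Z ω * κ (X ω) s ∂ν| ≤ 2 * H := by
    intro s hs
    by_cases hsc : s < c
    · have : ∫ ω in P, Z ω * κ (X ω) s ∂ν = - ∫ ω in X ⁻¹' Ioc a s, Z ω ∂ν := by
        have e : (fun ω => Z ω * κ (X ω) s) = fun ω => - ((X ⁻¹' Iic s).indicator Z ω) := by
          ext ω
          by_cases h : s < X ω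
          · have h' : ¬ X ω ≤ s := not_le.2 h
            simp [κ, h, hsc, h']
          · have h' : X ω ≤ s := not_lt.1 h
            simp [κ, h, hsc, h']
        rw [e, integral_neg, setIntegral_indicator (hX measurableSet_Iic)]
        have : P ∩ X ⁻¹' Iic s = X ⁻¹' Ioc a s := by
          ext ω
          simp only [hP, mem_inter_iff, mem_preimage, mem_Ioo, mem_Iic, mem_Ioc]
          exact ⟨fun h => ⟨h.1.1, h.2⟩, fun h => ⟨⟨h.1, h.2.trans_lt hs.2⟩, h.2⟩⟩
        rw [this]
      rw [this, abs_neg]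
      exact h1 a s hs.1.le ⟨le_rfl, hab.le⟩ ⟨hs.1.le, hs.2.le⟩
    · have : ∫ ω in P, Z ω * κ (X ω) s ∂ν = ∫ ω in X ⁻¹' Ioo s b, Z ω ∂ν := by
        have e : (fun ω => Z ω * κ (X ω) s) = ((X ⁻¹' Ioi s).indicator Z) := by
          ext ω
          by_cases h : s < X ω <;> simp [κ, h, hsc]
        rw [e, setIntegral_indicator (hX measurableSet_Ioi)]
        have : P ∩ X ⁻¹' Ioi s = X ⁻¹' Ioo s b := by
          ext ω
          simp only [hP, mem_inter_iff, mem_preimage, mem_Ioo, mem_Ioi]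
          exact ⟨fun h => ⟨h.2, h.1.2⟩, fun h => ⟨⟨hs.1.trans h.1, h.2⟩, h.1⟩⟩
        rw [this]
      rw [this]
      exact h1' s ⟨hs.1.le, hs.2.le⟩
  rw [hmain]
  have hA : |(g c - w) * ∫ ω in P, Z ω ∂ν| ≤ |g c - w| * (2 * H) := by
    rw [abs_mul]
    gcongr
    exact h1' a ⟨le_rfl, hab.le⟩
  have hBB : |∫ s in Ioo a b, deriv g s * ∫ ω in P, Z ω * κ (X ω) s ∂ν| ≤
      (∫ t in Ioo a b, |deriv g t|) * (2 * H) := by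
    rw [← integral_mul_const, ← Real.norm_eq_abs]
    apply norm_integral_le_of_norm_le (hint.abs.mul_const _)
    filter_upwards [ae_restrict_mem measurableSet_Ioo] with s hs
    rw [Real.norm_eq_abs, abs_mul]
    gcongr
    exact hin s hs
  refine (abs_add_le _ _).trans ?_
  linarith

/-- piece estimate, squared -/
lemma sid_piece_sq {Ω : Type*} [MeasurableSpace Ω] (ν : Measure Ω) [IsFiniteMeasure ν]
    (X : Ω → ℝ) (hX : Measurable X) (Z : Ω → ℝ) (hZ : Integrable Z ν)
    (g : ℝ → ℝ) (a b H w β B : ℝ) (hab : a < b) (hβ : 0 ≤ β) (hg : Measurable g) (hB : ∀ x, |g x| ≤ B)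
    (hdiff : ∀ s ∈ Ioo a b, DifferentiableAt ℝ g s)
    (hL : ∀ c d, c < d → Icc c d ⊆ Ioo a b → ∀ w : ℝ,
      (∫ t in c..d, |deriv g t|) ^ 2 ≤ β ^ 2 / (d - c) * ∫ t in c..d, (g t - w) ^ 2)
    (hb0 : ν {ω | X ω = b} = 0)
    (hH : ∀ s ∈ Icc a b, |∫ ω in {ω | X ω ≤ s}, Z ω ∂ν| ≤ H) :
    (∫ ω in X ⁻¹' Ioo a b, (g (X ω) - w) * Z ω ∂ν) ^ 2 ≤
      4 * H ^ 2 * (1 + β) ^ 2 * ((∫ t in Ioo a b, (g t - w) ^ 2) / (b - a)) := by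
  obtain ⟨hint, htv⟩ := sid_tv g a b β B hab hg hB hdiff hL w
  have hH0 : 0 ≤ H := (abs_nonneg _).trans (hH a ⟨le_rfl, hab.le⟩)
  have hsqint : IntegrableOn (fun t => (g t - w) ^ 2) (Ioo a b) := by
    refine Integrable.of_bound ?_ ((B + |w|) ^ 2) ?_
    · exact ((hg.sub_const w).pow_const 2).aestronglyMeasurable
    · refine Eventually.of_forall fun x => ?_
      rw [Real.norm_eq_abs, abs_pow]
      gcongr
      exact (abs_sub _ _).trans (by gcongr; exact hB x)
  have hba : 0 < b - a := by linarith
  obtain ⟨c, hc, hcle⟩ := exists_le_setAverage (μ := volume) (s := Ioo a b)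
    (by simp [hab]) (by simp) hsqint
  rw [setAverage_eq] at hcle
  simp only [Measure.real, Real.volume_Ioo, ENNReal.toReal_ofReal hba.le, smul_eq_mul] at hcle
  set I2 := ∫ t in Ioo a b, (g t - w) ^ 2 with hI2
  have hI2nn : 0 ≤ I2 := integral_nonneg fun _ => sq_nonneg _
  set D := √(I2 / (b - a)) with hD
  have hDsq : D ^ 2 = I2 / (b - a) := Real.sq_sqrt (by positivity)
  have hD0 : 0 ≤ D := Real.sqrt_nonneg _
  have h1 : |g c - w| ≤ D := by
    apply abs_le_of_sq_le_sq _ hD0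
    rw [hDsq]; refine hcle.trans (le_of_eq ?_); field_simp
  have h2 : ∫ t in Ioo a b, |deriv g t| ≤ β * D := by
    apply le_of_sq_le_sq _ (by positivity)
    rw [mul_pow, hDsq]; refine htv.trans (le_of_eq ?_); field_simp
  have h3 := sid_piece ν X hX Z hZ g a b c H w hc hdiff hint hb0 hH
  have h4 : |∫ ω in X ⁻¹' Ioo a b, (g (X ω) - w) * Z ω ∂ν| ≤ 2 * H * ((1 + β) * D) := by
    refine h3.trans ?_
    gcongr
    linarith
  rw [← hDsq, ← sq_abs]
  calc _ ≤ (2 * H * ((1 + β) * D)) ^ 2 := by gcongr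
    _ = _ := by ring

lemma sid_bdd_int {Ω : Type*} [MeasurableSpace Ω] (ν : Measure Ω) [IsFiniteMeasure ν]
    (f : Ω → ℝ) (hf : Measurable f) (B : ℝ) (hB : ∀ x, |f x| ≤ B) : Integrable f ν :=
  Integrable.of_bound hf.aestronglyMeasurable B (Eventually.of_forall hB)

lemma sid_bdd_sq_int {Ω : Type*} [MeasurableSpace Ω] (ν : Measure Ω) [IsFiniteMeasure ν]
    (f : Ω → ℝ) (hf : Measurable f) (B : ℝ) (hB : ∀ x, |f x| ≤ B) (c : ℝ) :
    Integrable (fun x => (f x - c) ^ 2) ν := by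
  refine sid_bdd_int ν _ ((hf.sub_const c).pow_const 2) ((B + |c|) ^ 2) fun x => ?_
  rw [abs_pow]
  gcongr
  exact (abs_sub _ _).trans (by gcongr; exact hB x)

lemma sid_condVar {p : ℕ} (μ : Measure (Fin p → ℝ)) [IsFiniteMeasure μ] (f : (Fin p → ℝ) → ℝ)
    (A : Set (Fin p → ℝ)) :
    (μ A).toReal * condVar μ f A = ∫ x in A, (f x - condMean μ f A) ^ 2 ∂μ := by
  unfold condVar
  by_cases h : (μ A).toReal = 0
  · have h' : μ A = 0 := by
      rcases (ENNReal.toReal_eq_zero_iff _).1 h with h | h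
      · exact h
      · exact absurd h (measure_ne_top _ _)
    rw [h, zero_mul, Measure.restrict_eq_zero.2 h', integral_zero_measure]
  · field_simp

lemma sid_shift {p : ℕ} (μ : Measure (Fin p → ℝ)) [IsFiniteMeasure μ] (f : (Fin p → ℝ) → ℝ)
    (hf : Measurable f) (B : ℝ) (hB : ∀ x, |f x| ≤ B) (A : Set (Fin p → ℝ)) (c : ℝ) :
    (μ A).toReal * condVar μ f A =
      ∫ x in A, (f x - c) ^ 2 ∂μ - (∫ x in A, (f x - c) ∂μ) ^ 2 / (μ A).toReal := by
  rw [sid_condVar]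
  have hi := sid_bdd_int (μ.restrict A) f hf B hB
  have hi2 := sid_bdd_sq_int (μ.restrict A) f hf B hB c
  by_cases h : (μ A).toReal = 0
  · have h' : μ A = 0 := by
      rcases (ENNReal.toReal_eq_zero_iff _).1 h with h | h
      · exact h
      · exact absurd h (measure_ne_top _ _)
    rw [Measure.restrict_eq_zero.2 h']; simp
  · set m := condMean μ f A with hm
    have e : ∫ x in A, (f x - m) ^ 2 ∂μ = ∫ x in A, ((f x - c) ^ 2 - 2 * (m - c) * (f x - c) + (m - c) ^ 2) ∂μ := by
      congr 1; ext x; ring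
    have hI : ∫ x in A, (f x - c) ∂μ = ∫ x in A, f x ∂μ - c * (μ A).toReal := by
      rw [integral_sub hi (integrable_const _)]
      simp [Measure.real, mul_comm]
    have hmI : ∫ x in A, f x ∂μ = m * (μ A).toReal := by
      rw [hm, condMean]; field_simp
    have hi3 : Integrable (fun x => 2 * (m - c) * (f x - c)) (μ.restrict A) :=
      (hi.sub (integrable_const _)).const_mul _
    have hi4 : Integrable (fun x => (f x - c) ^ 2 - 2 * (m - c) * (f x - c)) (μ.restrict A) := hi2.sub hi3
    rw [e, integral_add hi4 (integrable_const _),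
      integral_sub hi2 hi3, integral_const_mul, hI, hmI]
    simp only [integral_const, Measure.real, Measure.restrict_apply_univ, smul_eq_mul]
    field_simp
    ring

lemma sid_impurity {p : ℕ} (μ : Measure (Fin p → ℝ)) [IsFiniteMeasure μ] (f : (Fin p → ℝ) → ℝ)
    (hf : Measurable f) (B : ℝ) (hB : ∀ x, |f x| ≤ B) (A : Set (Fin p → ℝ)) (hA : MeasurableSet A)
    (j : Fin p) (b : ℝ) :
    0 ≤ impurity μ f A j b ∧ impurity μ f A j b ≤ (μ A).toReal * condVar μ f A ∧
    (∫ x in cellL A j b, (f x - condMean μ f A) ∂μ) ^ 2 * (μ A).toReal ≤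
      impurity μ f A j b * ((μ (cellL A j b)).toReal * (μ (cellR A j b)).toReal) ∧
    (μ (cellL A j b)).toReal + (μ (cellR A j b)).toReal = (μ A).toReal := by
  set c := condMean μ f A with hc
  have hLm : MeasurableSet (cellL A j b) := hA.inter (measurableSet_le (measurable_pi_apply j) measurable_const)
  have hRm : MeasurableSet (cellR A j b) := hA.inter (measurableSet_lt measurable_const (measurable_pi_apply j))
  have hdisj : Disjoint (cellL A j b) (cellR A j b) := by
    rw [Set.disjoint_left]
    rintro x ⟨-, (hx : x j ≤ b)⟩ ⟨-, (hx' : b < x j)⟩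
    exact absurd (lt_of_lt_of_le hx' hx) (lt_irrefl _)
  have hun : cellL A j b ∪ cellR A j b = A := by
    ext x
    simp only [cellL, cellR, mem_union, mem_inter_iff]
    constructor
    · rintro (h | h) <;> exact h.1
    · intro h
      rcases le_or_gt (x j) b with h' | h'
      · exact Or.inl ⟨h, h'⟩
      · exact Or.inr ⟨h, h'⟩
  set L := cellL A j b with hL
  set R := cellR A j b with hR
  have hmass : (μ L).toReal + (μ R).toReal = (μ A).toReal := by
    rw [← hun, measure_union hdisj hRm, ENNReal.toReal_add (measure_ne_top _ _) (measure_ne_top _ _)]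
  have hi : ∀ S : Set (Fin p → ℝ), IntegrableOn (fun x => f x - c) S μ := fun S =>
    (sid_bdd_int (μ.restrict S) f hf B hB).sub (integrable_const _)
  have hi2 : ∀ S : Set (Fin p → ℝ), IntegrableOn (fun x => (f x - c) ^ 2) S μ := fun S =>
    sid_bdd_sq_int (μ.restrict S) f hf B hB c
  have hsum1 : ∫ x in A, (f x - c) ∂μ = ∫ x in L, (f x - c) ∂μ + ∫ x in R, (f x - c) ∂μ := by
    rw [← setIntegral_union hdisj hRm (hi _) (hi _), hun]
  have hsum2 : ∫ x in A, (f x - c) ^ 2 ∂μ = ∫ x in L, (f x - c) ^ 2 ∂μ + ∫ x in R, (f x - c) ^ 2 ∂μ := by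
    rw [← setIntegral_union hdisj hRm (hi2 _) (hi2 _), hun]
  have hz : ∀ S : Set (Fin p → ℝ), (μ S).toReal = 0 → ∫ x in S, (f x - c) ∂μ = 0 := by
    intro S h
    have h' : μ S = 0 := by
      rcases (ENNReal.toReal_eq_zero_iff _).1 h with h | h
      · exact h
      · exact absurd h (measure_ne_top _ _)
    rw [Measure.restrict_eq_zero.2 h']; simp
  have h0 : ∫ x in A, (f x - c) ∂μ = 0 := by
    by_cases h : (μ A).toReal = 0
    · exact hz A h
    · rw [integral_sub (sid_bdd_int (μ.restrict A) f hf B hB) (integrable_const _)]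
      simp only [integral_const, Measure.real, Measure.restrict_apply_univ, smul_eq_mul]
      rw [hc, condMean]; field_simp; ring
  set hl := ∫ x in L, (f x - c) ∂μ with hhl
  have hr : ∫ x in R, (f x - c) ∂μ = - hl := by linarith
  have himp : impurity μ f A j b = hl ^ 2 / (μ L).toReal + hl ^ 2 / (μ R).toReal := by
    unfold impurity
    rw [← hL, ← hR, sid_shift μ f hf B hB A c, sid_shift μ f hf B hB L c, sid_shift μ f hf B hB R c,
      h0, hr, hsum2, ← hhl]
    ring
  have hLn : 0 ≤ (μ L).toReal := ENNReal.toReal_nonneg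
  have hRn : 0 ≤ (μ R).toReal := ENNReal.toReal_nonneg
  refine ⟨by rw [himp]; positivity, ?_, ?_, hmass⟩
  · have h1 : 0 ≤ (μ L).toReal * condVar μ f L := by
      rw [sid_condVar]; exact integral_nonneg fun _ => sq_nonneg _
    have h2 : 0 ≤ (μ R).toReal * condVar μ f R := by
      rw [sid_condVar]; exact integral_nonneg fun _ => sq_nonneg _
    unfold impurity
    rw [← hL, ← hR]
    linarith
  · rw [himp, ← hmass]
    by_cases hL0 : (μ L).toReal = 0
    · have : hl = 0 := hz L hL0
      rw [this]; simp
    by_cases hR0 : (μ R).toReal = 0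
    · have : hl = 0 := by have := hz R hR0; linarith
      rw [this]; simp
    apply le_of_eq
    field_simp
    ring

lemma sid_knots_mono (r : ℕ) (t : ℕ → ℝ) (hmono : ∀ j < r, t j < t (j + 1)) :
    ∀ i j, i ≤ j → j ≤ r → t i ≤ t j := by
  intro i j hij
  induction j, hij using Nat.le_induction with
  | base => intro _; exact le_rfl
  | succ m hm ih => intro h; exact (ih (by omega)).trans (hmono m (by omega)).le

lemma sid_knots_cover (r : ℕ) (t : ℕ → ℝ) (x : ℝ) (h0 : t 0 ≤ x) (h1 : x ≤ t r)
    (hne : ∀ j ≤ r, x ≠ t j) : ∃ j < r, x ∈ Ioo (t j) (t (j + 1)) := by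
  have hex : ∃ m, x < t m := ⟨r, lt_of_le_of_ne h1 (hne r le_rfl)⟩
  have hm := Nat.find_spec hex
  have hmr : Nat.find hex ≤ r := Nat.find_min' hex (lt_of_le_of_ne h1 (hne r le_rfl))
  have hpos : Nat.find hex ≠ 0 := by
    intro h; rw [h] at hm; linarith
  obtain ⟨j, hj⟩ := Nat.exists_eq_succ_of_ne_zero hpos
  have hjlt : ¬ x < t j := Nat.find_min hex (by omega)
  refine ⟨j, by omega, ?_, ?_⟩
  · exact lt_of_le_of_ne (not_lt.1 hjlt) (Ne.symm (hne j (by omega)))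
  · rw [hj] at hm; exact hm

lemma sid_coord {Ω : Type*} [MeasurableSpace Ω] (ν : Measure Ω) [IsFiniteMeasure ν]
    (X : Ω → ℝ) (hX : Measurable X) (Z : Ω → ℝ) (hZm : Measurable Z) (CZ : ℝ) (hZb : ∀ ω, |Z ω| ≤ CZ)
    (g : ℝ → ℝ) (r : ℕ) (hr : 1 ≤ r) (t : ℕ → ℝ) (α β B w κ M S N e0 e1 : ℝ) (hα : 0 < α) (hβ : 0 ≤ β)
    (hg : Measurable g) (hB : ∀ x, |g x| ≤ B)
    (ht0 : t 0 = 0) (htr : t r = 1)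
    (hgap : ∀ j < r, α / r ≤ t (j + 1) - t j)
    (hmono : ∀ j < r, t j < t (j + 1))
    (hdiff : ∀ j < r, ∀ s ∈ Ioo (t j) (t (j + 1)), DifferentiableAt ℝ g s)
    (hL : ∀ j < r, ∀ c d, c < d → Icc c d ⊆ Ioo (t j) (t (j + 1)) → ∀ w : ℝ,
      (∫ t in c..d, |deriv g t|) ^ 2 ≤ β ^ 2 / (d - c) * ∫ t in c..d, (g t - w) ^ 2)
    (he : e0 < e1) (he0 : 0 ≤ e0) (he1 : e1 ≤ 1)
    (hXE : ∀ᵐ ω ∂ν, X ω ∈ Icc e0 e1) (hatom : ∀ c, ν {ω | X ω = c} = 0)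
    (hN : N = (ν univ).toReal) (hN0 : 0 < N) (hS : 0 ≤ S)
    (hslab : ∀ u v, u ≤ v → (ν (X ⁻¹' Icc u v)).toReal ≤ κ * N * ((v - u) / (e1 - e0)))
    (hM1 : 2 * r * κ ≤ M) (hM2 : (r : ℝ) ^ 2 / (2 * α) ≤ M)
    (hh : ∀ s, (∫ ω in {ω | X ω ≤ s}, Z ω ∂ν) ^ 2 * N ≤
      S * ((ν {ω | X ω ≤ s}).toReal * (ν {ω | s < X ω}).toReal)) :
    (∫ ω, (g (X ω) - w) * Z ω ∂ν) ^ 2 ≤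
      2 * (1 + β) ^ 2 * S * N * M * ((∫ x in Ioo e0 e1, (g x - w) ^ 2) / (e1 - e0)) := by
  have hr0 : (0 : ℝ) < r := by exact_mod_cast hr
  have hM0 : 0 < M := lt_of_lt_of_le (by positivity) hM2
  have he' : 0 < e1 - e0 := by linarith
  set a : ℕ → ℝ := fun j => max (t j) e0 with ha
  set b : ℕ → ℝ := fun j => min (t (j + 1)) e1 with hb
  have hZ : Integrable Z ν := sid_bdd_int ν Z hZm CZ hZb
  have hmon := sid_knots_mono r t hmono
  have hIdisj : ∀ i < r, ∀ j < r, i ≠ j → Disjoint (Ioo (a i) (b i)) (Ioo (a j) (b j)) := by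
    have main : ∀ i < r, ∀ j < r, i < j → Disjoint (Ioo (a i) (b i)) (Ioo (a j) (b j)) := by
      intro i hi j hj hij
      rw [Set.disjoint_left]
      rintro x hx hx'
      have h1 : x < t (i + 1) := hx.2.trans_le (min_le_left _ _)
      have h2 : t j < x := (le_max_left _ _).trans_lt hx'.1
      have h3 := hmon (i + 1) j (by omega) hj.le
      linarith
    intro i hi j hj hij
    rcases lt_or_gt_of_ne hij with h | h
    · exact main i hi j hj h
    · exact (main j hj i hi h).symm
  set T : ℕ → ℝ := fun j => ∫ ω in X ⁻¹' Ioo (a j) (b j), (g (X ω) - w) * Z ω ∂ν with hT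
  set I : ℕ → ℝ := fun j => ∫ x in Ioo (a j) (b j), (g x - w) ^ 2 with hI
  have hIntZ : Integrable (fun ω => (g (X ω) - w) * Z ω) ν := by
    refine sid_bdd_int ν _ (((hg.comp hX).sub_const w).mul hZm) ((B + |w|) * CZ) fun ω => ?_
    rw [abs_mul]
    have h1 : |g (X ω) - w| ≤ B + |w| := (abs_sub _ _).trans (by gcongr; exact hB _)
    exact mul_le_mul h1 (hZb ω) (abs_nonneg _) ((abs_nonneg _).trans h1)
  have hsumT : ∫ ω, (g (X ω) - w) * Z ω ∂ν = ∑ j ∈ Finset.range r, T j := by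
    rw [hT, ← integral_biUnion_finset]
    · rw [← setIntegral_univ]
      apply setIntegral_congr_set
      have h1 : ∀ᵐ ω ∂ν, ∀ j ∈ Finset.range (r + 1), X ω ≠ t j := by
        rw [Finset.eventually_all]
        intro j _
        rw [ae_iff]; simpa using hatom (t j)
      have h2 : ∀ᵐ ω ∂ν, X ω ≠ e0 := by rw [ae_iff]; simpa using hatom e0
      have h3 : ∀ᵐ ω ∂ν, X ω ≠ e1 := by rw [ae_iff]; simpa using hatom e1
      filter_upwards [h1, h2, h3, hXE] with ω h1 h2 h3 h4
      apply propext
      refine ⟨fun _ => ?_, fun _ => trivial⟩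
      obtain ⟨j, hj, hjx⟩ := sid_knots_cover r t (X ω) (by rw [ht0]; linarith [h4.1]) (by rw [htr]; linarith [h4.2])
        (fun j hj => h1 j (Finset.mem_range.2 (by omega)))
      change ω ∈ ⋃ i ∈ Finset.range r, X ⁻¹' Ioo (a i) (b i)
      simp only [mem_iUnion]
      refine ⟨j, Finset.mem_range.2 hj, ?_, ?_⟩
      · exact max_lt hjx.1 (lt_of_le_of_ne h4.1 (Ne.symm h2))
      · exact lt_min hjx.2 (lt_of_le_of_ne h4.2 h3)
    · intro j _; exact hX measurableSet_Ioo
    · intro i hi j hj hij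
      exact (hIdisj i (by simpa using hi) j (by simpa using hj) hij).preimage X
    · intro j _; exact hIntZ.integrableOn
  have hsqint : IntegrableOn (fun x => (g x - w) ^ 2) (Ioo e0 e1) :=
    sid_bdd_sq_int (volume.restrict (Ioo e0 e1)) g hg B hB w
  have hsubI : ∀ j, Ioo (a j) (b j) ⊆ Ioo e0 e1 := fun j =>
    Ioo_subset_Ioo (le_max_right _ _) (min_le_right _ _)
  have hsumI : ∑ j ∈ Finset.range r, I j ≤ ∫ x in Ioo e0 e1, (g x - w) ^ 2 := by
    rw [hI, ← integral_biUnion_finset]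
    · apply setIntegral_mono_set hsqint (Eventually.of_forall fun _ => sq_nonneg _)
      exact (iUnion₂_subset fun j _ => hsubI j).eventuallyLE
    · intro j _; exact measurableSet_Ioo
    · intro i hi j hj hij
      exact hIdisj i (by simpa using hi) j (by simpa using hj) hij
    · intro j _; exact hsqint.mono_set (hsubI j)
  have hTj : ∀ j < r, T j ^ 2 ≤ 2 * (1 + β) ^ 2 * S * N * M / r / (e1 - e0) * I j := by
    intro j hj
    have hI0 : 0 ≤ I j := integral_nonneg fun _ => sq_nonneg _
    rcases le_or_gt (b j) (a j) with hba | hab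
    · have : T j = 0 := by simp only [hT]; rw [Ioo_eq_empty (not_lt.2 hba)]; simp
      rw [this, zero_pow two_ne_zero]
      positivity
    set q := M / (2 * r) * ((b j - a j) / (e1 - e0)) with hq
    have hab' : 0 < b j - a j := by linarith
    have hq0 : 0 ≤ q := by positivity
    have hmass : ∀ s, (ν {ω | X ω ≤ s}).toReal + (ν {ω | s < X ω}).toReal = N := by
      intro s
      rw [hN, ← ENNReal.toReal_add (measure_ne_top _ _) (measure_ne_top _ _), ← measure_union]
      · congr 2
        ext ω
        simp only [mem_union, mem_univ, iff_true]
        exact le_or_gt (X ω) s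
      · rw [Set.disjoint_left]
        intro ω (h1 : X ω ≤ s) (h2 : s < X ω)
        linarith
      · exact measurableSet_lt measurable_const hX
    have hq2 : ∀ s ∈ Icc (a j) (b j), (ν {ω | X ω ≤ s}).toReal * (ν {ω | s < X ω}).toReal ≤ N ^ 2 * q := by
      intro s hs
      have hm := hmass s
      set mL := (ν {ω | X ω ≤ s}).toReal with hmL
      set mR := (ν {ω | s < X ω}).toReal with hmR
      have hmL0 : 0 ≤ mL := ENNReal.toReal_nonneg
      have hmR0 : 0 ≤ mR := ENNReal.toReal_nonneg
      have hκq : κ * ((b j - a j) / (e1 - e0)) ≤ q := by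
        rw [hq]; gcongr
        rw [le_div_iff₀ (by positivity)]; linarith
      rcases le_or_gt (t j) e0 with h1 | h1
      · have haj : a j = e0 := max_eq_right h1
        have : mL ≤ κ * N * ((b j - a j) / (e1 - e0)) := by
          refine le_trans ?_ (hslab (a j) (b j) hab.le)
          apply ENNReal.toReal_mono (measure_ne_top _ _)
          apply measure_mono_ae
          filter_upwards [hXE] with ω hω (h : X ω ≤ s)
          exact ⟨haj ▸ hω.1, h.trans hs.2⟩
        calc mL * mR ≤ (κ * N * ((b j - a j) / (e1 - e0))) * N :=
              mul_le_mul this (by linarith) hmR0 (hmL0.trans this)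
          _ = N ^ 2 * (κ * ((b j - a j) / (e1 - e0))) := by ring
          _ ≤ N ^ 2 * q := by gcongr
      rcases le_or_gt e1 (t (j + 1)) with h2 | h2
      · have hbj : b j = e1 := min_eq_right h2
        have : mR ≤ κ * N * ((b j - a j) / (e1 - e0)) := by
          refine le_trans ?_ (hslab (a j) (b j) hab.le)
          apply ENNReal.toReal_mono (measure_ne_top _ _)
          apply measure_mono_ae
          filter_upwards [hXE] with ω hω (h : s < X ω)
          exact ⟨hs.1.trans h.le, hbj ▸ hω.2⟩
        calc mL * mR ≤ N * (κ * N * ((b j - a j) / (e1 - e0))) :=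
              mul_le_mul (by linarith) this hmR0 hN0.le
          _ = N ^ 2 * (κ * ((b j - a j) / (e1 - e0))) := by ring
          _ ≤ N ^ 2 * q := by gcongr
      · have haj : a j = t j := max_eq_left h1.le
        have hbj : b j = t (j + 1) := min_eq_left h2.le
        have hq4 : 1 / 4 ≤ q := by
          have h3 : α / r ≤ (b j - a j) / (e1 - e0) := by
            rw [le_div_iff₀ he']
            have := hgap j hj
            rw [haj, hbj]
            have : α / r * (e1 - e0) ≤ α / r * 1 := by gcongr; linarith
            linarith
          calc (1 : ℝ) / 4 = (r ^ 2 / (2 * α)) / (2 * r) * (α / r) := by field_simp; norm_num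
            _ ≤ q := by rw [hq]; gcongr
        nlinarith [sq_nonneg (mL - mR), mul_le_mul_of_nonneg_left hq4 (sq_nonneg N)]
    set H := √(S * N * q) with hH
    have hHsq : H ^ 2 = S * N * q := Real.sq_sqrt (by positivity)
    have hHb : ∀ s ∈ Icc (a j) (b j), |∫ ω in {ω | X ω ≤ s}, Z ω ∂ν| ≤ H := by
      intro s hs
      apply Real.abs_le_sqrt
      have h1 := hh s
      have h2 : S * ((ν {ω | X ω ≤ s}).toReal * (ν {ω | s < X ω}).toReal) ≤ S * (N ^ 2 * q) := by
        exact mul_le_mul_of_nonneg_left (hq2 s hs) hS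
      have h3 : (∫ ω in {ω | X ω ≤ s}, Z ω ∂ν) ^ 2 * N ≤ (S * N * q) * N := by
        refine (h1.trans h2).trans (le_of_eq (by ring))
      exact le_of_mul_le_mul_right h3 hN0
    have hsub : Ioo (a j) (b j) ⊆ Ioo (t j) (t (j + 1)) := Ioo_subset_Ioo (le_max_left _ _) (min_le_left _ _)
    have := sid_piece_sq ν X hX Z hZ g (a j) (b j) H w β B hab hβ hg hB
      (fun s hs => hdiff j hj s (hsub hs)) (fun c d hcd hs => hL j hj c d hcd (hs.trans hsub)) (hatom _) hHb
    refine this.trans (le_of_eq ?_)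
    rw [hHsq, hq]
    simp only [hI]
    field_simp
    ring
  rw [hsumT]
  calc _ ≤ (r : ℝ) * ∑ j ∈ Finset.range r, T j ^ 2 := by
        simpa using sq_sum_le_card_mul_sum_sq (s := Finset.range r) (f := T)
    _ ≤ (r : ℝ) * ∑ j ∈ Finset.range r, 2 * (1 + β) ^ 2 * S * N * M / r / (e1 - e0) * I j := by
        gcongr with j hj
        exact hTj j (by simpa using hj)
    _ = 2 * (1 + β) ^ 2 * S * N * M / (e1 - e0) * ∑ j ∈ Finset.range r, I j := by
        rw [← Finset.mul_sum]; field_simp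
    _ ≤ 2 * (1 + β) ^ 2 * S * N * M / (e1 - e0) * ∫ x in Ioo e0 e1, (g x - w) ^ 2 := by
        gcongr
    _ = _ := by ring

lemma sid_orth (p : ℕ) (E : Fin p → Set ℝ) (hEm : ∀ k, MeasurableSet (E k))
    (hE0 : ∀ k, volume (E k) ≠ 0) (hE1 : ∀ k, volume (E k) ≠ ⊤) (f : Fin p → ℝ → ℝ)
    (hf : ∀ k, Measurable (f k)) (B : ℝ) (hB : ∀ k x, |f k x| ≤ B) (c : ℝ) :
    ∃ w : Fin p → ℝ, (∑ k, (∫ x in E k, (f k x - w k) ^ 2) / (volume (E k)).toReal) *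
      (volume (univ.pi E)).toReal ≤ ∫ x in univ.pi E, (∑ k, f k (x k) - c) ^ 2 := by
  let P : Fin p → Measure ℝ := fun k => (volume (E k))⁻¹ • volume.restrict (E k)
  have hP : ∀ k, IsProbabilityMeasure (P k) := fun k => ⟨by
    simp only [P, Measure.smul_apply, Measure.restrict_apply_univ, smul_eq_mul]
    exact ENNReal.inv_mul_cancel (hE0 k) (hE1 k)⟩
  have hvolA : volume (univ.pi E) = ∏ k, volume (E k) := by rw [volume_pi, Measure.pi_pi]
  have hpi : Measure.pi P = (volume (univ.pi E))⁻¹ • volume.restrict (univ.pi E) := by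
    apply Measure.pi_eq
    intro s hs
    rw [Measure.smul_apply, volume_pi, Measure.restrict_pi_pi, Measure.pi_pi, Measure.pi_pi]
    simp only [P, Measure.smul_apply, smul_eq_mul]
    rw [Finset.prod_mul_distrib, ENNReal.prod_inv_distrib]
    intro i _ j _ _
    left; exact hE0 i
  have hvol0 : volume (univ.pi E) ≠ 0 := by
    rw [hvolA]; exact Finset.prod_ne_zero_iff.2 fun k _ => hE0 k
  have hvol1 : volume (univ.pi E) ≠ ⊤ := by
    rw [hvolA]; exact ENNReal.prod_ne_top fun k _ => hE1 k
  have hmem : ∀ k, MemLp (f k) 2 (P k) := fun k =>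
    MemLp.of_bound (hf k).aestronglyMeasurable B (Eventually.of_forall (hB k))
  refine ⟨fun k => ∫ x, f k x ∂(P k), ?_⟩
  have h1 := ProbabilityTheory.variance_sum_pi hmem
  have hYm : Measurable (∑ k, fun x : Fin p → ℝ => f k (x k)) := by
    have h : (∑ k, fun x : Fin p → ℝ => f k (x k)) = fun x => ∑ k, f k (x k) := by ext x; simp
    rw [h]
    exact Finset.measurable_sum _ fun k _ => (hf k).comp (measurable_pi_apply k)
  have h2 : ProbabilityTheory.variance (∑ k, fun x : Fin p → ℝ => f k (x k)) (Measure.pi P) ≤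
      (volume (univ.pi E)).toReal⁻¹ * ∫ x in univ.pi E, (∑ k, f k (x k) - c) ^ 2 := by
    rw [← ProbabilityTheory.variance_sub_const hYm.aestronglyMeasurable c]
    refine (ProbabilityTheory.variance_le_expectation_sq (hYm.sub_const c).aestronglyMeasurable).trans (le_of_eq ?_)
    rw [hpi, integral_smul_measure, ENNReal.toReal_inv, smul_eq_mul]
    simp
  have h3 : ∀ k, ProbabilityTheory.variance (f k) (P k) =
      (∫ x in E k, (f k x - ∫ x, f k x ∂(P k)) ^ 2) / (volume (E k)).toReal := by
    intro k
    rw [ProbabilityTheory.variance_eq_integral (hf k).aemeasurable]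
    generalize (∫ x, f k x ∂(P k)) = m
    simp only [P]
    rw [integral_smul_measure, ENNReal.toReal_inv, smul_eq_mul, div_eq_inv_mul]
  rw [h1] at h2
  simp only [h3] at h2
  have hpos : 0 < (volume (univ.pi E)).toReal := ENNReal.toReal_pos hvol0 hvol1
  rw [inv_mul_eq_div, le_div_iff₀ hpos] at h2
  exact h2

lemma sid_slab (p : ℕ) (E : Fin p → Set ℝ) (k : Fin p) (hE1 : ∀ k, volume (E k) ≠ ⊤) (S : Set ℝ) (hS : MeasurableSet S) :
    ((volume.restrict (univ.pi E)) ((fun x : Fin p → ℝ => x k) ⁻¹' S)).toReal * (volume (E k)).toReal =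
      (volume (S ∩ E k)).toReal * (volume (univ.pi E)).toReal := by
  have : ∀ k, IsFiniteMeasure ((volume : Measure ℝ).restrict (E k)) := fun k =>
    ⟨by rw [Measure.restrict_apply_univ]; exact (hE1 k).lt_top⟩
  have key : ∀ S, MeasurableSet S → (volume.restrict (univ.pi E)) ((fun x : Fin p → ℝ => x k) ⁻¹' S) =
      (∏ j ∈ Finset.univ.erase k, volume (E j)) * volume (S ∩ E k) := by
    intro S hS
    rw [volume_pi, Measure.restrict_pi_pi]
    change (Measure.pi fun i => volume.restrict (E i)) (Function.eval k ⁻¹' S) = _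
    rw [← Measure.map_apply (measurable_pi_apply k) hS, Measure.pi_map_eval]
    simp [Measure.restrict_apply hS]
  have h2 := key univ MeasurableSet.univ
  simp only [preimage_univ, Measure.restrict_apply_univ, univ_inter] at h2
  rw [key S hS, h2, ENNReal.toReal_mul, ENNReal.toReal_mul]
  ring

lemma sid_core
    (p r : ℕ) (hp : 1 ≤ p) (hr : 1 ≤ r)
    (α β : ℝ) (hα : 0 < α) (hβ : 1 ≤ β)
    (μ : Measure (Fin p → ℝ)) [IsProbabilityMeasure μ]
    (θlo θhi : ℝ)
    (hθlo : 0 < θlo) (hθhi : 0 < θhi)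
    (hμlo : ENNReal.ofReal θlo • volume.restrict (box p) ≤ μ)
    (hμhi : μ ≤ ENNReal.ofReal θhi • volume.restrict (box p))
    (f : Fin p → ℝ → ℝ) (hfm : ∀ k, Measurable (f k)) (B : ℝ) (hB : ∀ k x, |f k x| ≤ B)
    (t : Fin p → ℕ → ℝ)
    (ht0 : ∀ k, t k 0 = 0) (htr : ∀ k, t k r = 1)
    (hgap : ∀ k, ∀ j < r, α / r ≤ t k (j + 1) - t k j)
    (hmono : ∀ k, ∀ j < r, t k j < t k (j + 1))
    (hdiff : ∀ k, ∀ j < r, ∀ s ∈ Set.Ioo (t k j) (t k (j + 1)), DifferentiableAt ℝ (f k) s)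
    (hL : ∀ k, ∀ j < r, ∀ c d, c < d → Icc c d ⊆ Ioo (t k j) (t k (j + 1)) → ∀ w : ℝ,
      (∫ t in c..d, |deriv (f k) t|) ^ 2 ≤ β ^ 2 / (d - c) * ∫ t in c..d, (f k t - w) ^ 2)
    (fstar : (Fin p → ℝ) → ℝ)
    (hadd : ∀ u, fstar u = ∑ k, f k (u k))
    (E : Fin p → Set ℝ) (hEo : ∀ j, (E j).OrdConnected) (hEs : ∀ j, E j ⊆ Set.Icc (0 : ℝ) 1) :
      (⨆ j : Fin p, ⨆ b : ℝ, impurity μ fstar (Set.univ.pi E) j b) ≥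
        θlo / (p * θhi *
            (max (2 * r * θhi / θlo) (r ^ 2 / (2 * α)) * max (9 * β ^ 2) (32 + β ^ 2))) *
          (μ (Set.univ.pi E)).toReal * condVar μ fstar (Set.univ.pi E) := by
  have hp0 : (0 : ℝ) < p := by exact_mod_cast hp
  have hr0 : (0 : ℝ) < r := by exact_mod_cast hr
  have : Nonempty (Fin p) := ⟨⟨0, hp⟩⟩
  set A : Set (Fin p → ℝ) := univ.pi E with hA
  have hEm : ∀ k, MeasurableSet (E k) := fun k => (hEo k).measurableSet
  have hAm : MeasurableSet A := MeasurableSet.univ_pi hEm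
  have hAbox : A ⊆ box p := Set.pi_mono fun k _ => hEs k
  have hfsm : Measurable fstar := by
    have : fstar = fun u => ∑ k, f k (u k) := funext hadd
    rw [this]
    exact Finset.measurable_sum _ fun k _ => (hfm k).comp (measurable_pi_apply k)
  have hfsB : ∀ x, |fstar x| ≤ p * B := by
    intro x
    rw [hadd]
    refine (Finset.abs_sum_le_sum_abs _ _).trans ?_
    refine (Finset.sum_le_sum fun k _ => hB k (x k)).trans (le_of_eq ?_)
    simp
  set N := (μ A).toReal with hN
  set V := N * condVar μ fstar A with hV
  have himp := sid_impurity μ fstar hfsm (p * B) hfsB A hAm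
  set S := ⨆ j : Fin p, ⨆ b : ℝ, impurity μ fstar A j b with hS
  have hleS : ∀ k b, impurity μ fstar A k b ≤ S := by
    intro k b
    have h1 : impurity μ fstar A k b ≤ ⨆ b : ℝ, impurity μ fstar A k b :=
      le_ciSup (f := fun b => impurity μ fstar A k b) ⟨V, by rintro _ ⟨b, rfl⟩; exact (himp k b).2.1⟩ b
    exact h1.trans (le_ciSup (f := fun k => ⨆ b : ℝ, impurity μ fstar A k b) (Set.finite_range _).bddAbove k)
  have hS0 : 0 ≤ S := (himp ⟨0, hp⟩ 0).1.trans (hleS _ _)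
  set M := max (2 * r * θhi / θlo) ((r : ℝ) ^ 2 / (2 * α)) with hM
  have hM0 : 0 < M := lt_of_lt_of_le (by positivity) (le_max_right _ _)
  set C := max (9 * β ^ 2) (32 + β ^ 2) with hC
  have hC0 : 0 < C := lt_of_lt_of_le (by positivity) (le_max_left _ _)
  have hVi : V = ∫ x in A, (fstar x - condMean μ fstar A) ^ 2 ∂μ := sid_condVar μ fstar A
  have hV0 : 0 ≤ V := by rw [hVi]; exact integral_nonneg fun _ => sq_nonneg _
  rw [ge_iff_le, mul_assoc, ← hV]
  rcases hV0.eq_or_lt with hV0 | hVpos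
  · rw [← hV0, mul_zero]; exact hS0
  have hN0 : 0 < N := by
    rcases (ENNReal.toReal_nonneg : 0 ≤ (μ A).toReal).eq_or_lt with h | h
    · rw [hV, hN, ← h, zero_mul] at hVpos; exact absurd hVpos (lt_irrefl _)
    · exact h
  -- measure comparison on A
  have hloA : ENNReal.ofReal θlo • volume.restrict A ≤ μ.restrict A := by
    have := Measure.restrict_mono (Subset.refl A) hμlo
    rwa [Measure.restrict_smul, Measure.restrict_restrict hAm, inter_eq_left.2 hAbox] at this
  have hhiA : μ.restrict A ≤ ENNReal.ofReal θhi • volume.restrict A := by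
    have := Measure.restrict_mono (Subset.refl A) hμhi
    rwa [Measure.restrict_smul, Measure.restrict_restrict hAm, inter_eq_left.2 hAbox] at this
  have hEfin : ∀ k, volume (E k) ≠ ⊤ := fun k =>
    ((measure_mono (hEs k)).trans_lt (by simp)).ne
  have hvolA : volume A = ∏ k, volume (E k) := by rw [hA, volume_pi, Measure.pi_pi]
  have hvA1 : volume A ≠ ⊤ := by rw [hvolA]; exact ENNReal.prod_ne_top fun k _ => hEfin k
  have hfinA : IsFiniteMeasure (volume.restrict A) := ⟨by rw [Measure.restrict_apply_univ]; exact hvA1.lt_top⟩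
  set vA := (volume A).toReal with hvA
  have hhiS : ∀ T : Set (Fin p → ℝ), ((μ.restrict A) T).toReal ≤ θhi * ((volume.restrict A) T).toReal := by
    intro T
    have h := hhiA T
    rw [Measure.smul_apply, smul_eq_mul] at h
    have := ENNReal.toReal_mono (ENNReal.mul_ne_top ENNReal.ofReal_ne_top (measure_ne_top _ _)) h
    rwa [ENNReal.toReal_mul, ENNReal.toReal_ofReal hθhi.le] at this
  have hloS : ∀ T : Set (Fin p → ℝ), θlo * ((volume.restrict A) T).toReal ≤ ((μ.restrict A) T).toReal := by
    intro T
    have h := hloA T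
    rw [Measure.smul_apply, smul_eq_mul] at h
    have := ENNReal.toReal_mono (measure_ne_top _ _) h
    rwa [ENNReal.toReal_mul, ENNReal.toReal_ofReal hθlo.le] at this
  have hNhi : N ≤ θhi * vA := by simpa using hhiS univ
  have hNlo : θlo * vA ≤ N := by simpa using hloS univ
  have hvApos : 0 < vA := by
    by_contra h
    push Not at h
    nlinarith
  have hE0 : ∀ k, volume (E k) ≠ 0 := by
    have : volume A ≠ 0 := by
      intro h; rw [hvA, h] at hvApos; simp at hvApos
    rw [hvolA] at this
    exact fun k => Finset.prod_ne_zero_iff.1 this k (Finset.mem_univ k)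
  set c := condMean μ fstar A with hc
  set Z : (Fin p → ℝ) → ℝ := fun x => fstar x - c with hZ
  have hZm : Measurable Z := hfsm.sub_const c
  have hZb : ∀ x, |Z x| ≤ p * B + |c| := fun x => (abs_sub _ _).trans (by gcongr; exact hfsB x)
  obtain ⟨w, hw⟩ := sid_orth p E hEm hE0 hEfin f hfm B hB c
  -- per-coordinate estimate
  have hcoord : ∀ k, (∫ x in A, (f k (x k) - w k) * Z x ∂μ) ^ 2 ≤
      2 * (1 + β) ^ 2 * S * N * M * ((∫ x in E k, (f k x - w k) ^ 2) / (volume (E k)).toReal) := by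
    intro k
    have hbb : BddBelow (E k) := ⟨0, fun x hx => (hEs k hx).1⟩
    have hba : BddAbove (E k) := ⟨1, fun x hx => (hEs k hx).2⟩
    have hne : (E k).Nonempty := nonempty_of_measure_ne_zero (hE0 k)
    set e0 := sInf (E k) with he0
    set e1 := sSup (E k) with he1
    have hsup : E k ⊆ Icc e0 e1 := fun x hx => ⟨csInf_le hbb hx, le_csSup hba hx⟩
    have hsub : Ioo e0 e1 ⊆ E k := by
      intro x hx
      obtain ⟨y, hy, hyx⟩ := exists_lt_of_csInf_lt hne hx.1
      obtain ⟨z, hz, hxz⟩ := exists_lt_of_lt_csSup hne hx.2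
      exact (hEo k).out hy hz ⟨hyx.le, hxz.le⟩
    have hvE : volume (E k) = ENNReal.ofReal (e1 - e0) := by
      apply le_antisymm
      · exact (measure_mono hsup).trans (by simp)
      · refine le_trans ?_ (measure_mono hsub); simp
    have hee : e0 < e1 := by
      by_contra h
      push Not at h
      apply hE0 k
      rw [hvE, ENNReal.ofReal_eq_zero]; linarith
    have hEe : (Ioo e0 e1 : Set ℝ) =ᵐ[volume] E k := by
      apply (HasSubset.Subset.eventuallyLE hsub).antisymm
      exact (HasSubset.Subset.eventuallyLE hsup).trans Ioo_ae_eq_Icc.symm.le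
    have hvEr : (volume (E k)).toReal = e1 - e0 := by
      rw [hvE, ENNReal.toReal_ofReal (by linarith)]
    rw [hvEr, ← setIntegral_congr_set hEe]
    have hXm : Measurable (fun x : Fin p → ℝ => x k) := measurable_pi_apply k
    refine sid_coord (μ.restrict A) (fun x => x k) hXm Z hZm (p * B + |c|) hZb
      (f k) r hr (t k) α β B (w k) (θhi / θlo) M S N e0 e1 hα (by linarith) (hfm k) (hB k) (ht0 k) (htr k)
      (hgap k) (hmono k) (hdiff k) (hL k) hee (le_csInf hne fun x hx => (hEs k hx).1)
      (csSup_le hne fun x hx => (hEs k hx).2) ?_ ?_ ?_ hN0 hS0 ?_ ?_ (le_max_right _ _) ?_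
    · filter_upwards [ae_restrict_mem hAm] with x hx
      exact hsup (hx k (mem_univ k))
    · intro d
      have h1 : (volume : Measure (Fin p → ℝ)) {x | x k = d} = 0 := by
        rw [volume_pi]; exact Measure.pi_hyperplane (fun _ : Fin p => (volume : Measure ℝ)) k d
      have h2 := hhiA {x | x k = d}
      rw [Measure.smul_apply, smul_eq_mul] at h2
      have h3 : (volume.restrict A) {x : Fin p → ℝ | x k = d} = 0 :=
        le_antisymm ((Measure.restrict_apply_le _ _).trans h1.le) zero_le
      rw [h3, mul_zero] at h2
      exact le_antisymm h2 zero_le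
    · rw [Measure.restrict_apply_univ]
    · intro u v huv
      have h1 := hhiS ((fun x : Fin p → ℝ => x k) ⁻¹' Icc u v)
      have h2 := sid_slab p E k hEfin (Icc u v) measurableSet_Icc
      rw [hvEr, ← hA, ← hvA] at h2
      have h3 : (volume (Icc u v ∩ E k)).toReal ≤ v - u := by
        have := ENNReal.toReal_mono (by simp) (measure_mono (μ := volume) (inter_subset_left (s := Icc u v) (t := E k)))
        rwa [Real.volume_Icc, ENNReal.toReal_ofReal (by linarith)] at this
      have hepos : 0 < e1 - e0 := by linarith
      set y := ((volume.restrict A) ((fun x : Fin p → ℝ => x k) ⁻¹' Icc u v)).toReal with hy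
      have h4 : y ≤ (v - u) / (e1 - e0) * vA := by
        rw [div_mul_eq_mul_div, le_div_iff₀ hepos, h2]
        gcongr
      have hvu : 0 ≤ (v - u) / (e1 - e0) := div_nonneg (by linarith) hepos.le
      calc _ ≤ θhi * y := h1
        _ ≤ θhi * ((v - u) / (e1 - e0) * vA) := by gcongr
        _ = θhi / θlo * (θlo * vA) * ((v - u) / (e1 - e0)) := by field_simp
        _ ≤ θhi / θlo * N * ((v - u) / (e1 - e0)) := by gcongr
    · refine le_trans (le_of_eq ?_) (le_max_left _ _); ring
    · intro s
      obtain ⟨-, -, h1, -⟩ := himp k s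
      have hLm : MeasurableSet {x : Fin p → ℝ | x k ≤ s} := measurableSet_le hXm measurable_const
      have hRm : MeasurableSet {x : Fin p → ℝ | s < x k} := measurableSet_lt measurable_const hXm
      rw [Measure.restrict_restrict hLm, Measure.restrict_apply hLm, Measure.restrict_apply hRm,
        inter_comm _ A, inter_comm _ A]
      refine h1.trans ?_
      exact mul_le_mul_of_nonneg_right (hleS k s) (by positivity)
  -- decomposition of V
  have hZi : Integrable Z (μ.restrict A) := sid_bdd_int _ Z hZm _ hZb
  have hZ0 : ∫ x in A, Z x ∂μ = 0 := by
    rw [hZ, integral_sub (sid_bdd_int (μ.restrict A) fstar hfsm _ hfsB) (integrable_const _)]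
    simp only [integral_const, Measure.real, Measure.restrict_apply_univ, smul_eq_mul]
    rw [← hN, hc, condMean, ← hN]; field_simp; ring
  have hTi : ∀ k, Integrable (fun x : Fin p → ℝ => (f k (x k) - w k) * Z x) (μ.restrict A) := by
    intro k
    refine sid_bdd_int _ _ ((((hfm k).comp (measurable_pi_apply k)).sub_const _).mul hZm)
      ((B + |w k|) * (p * B + |c|)) fun x => ?_
    rw [abs_mul]
    have h1 : |f k (x k) - w k| ≤ B + |w k| := (abs_sub _ _).trans (by gcongr; exact hB k _)
    exact mul_le_mul h1 (hZb x) (abs_nonneg _) ((abs_nonneg _).trans h1)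
  have hVsum : V = ∑ k, ∫ x in A, (f k (x k) - w k) * Z x ∂μ := by
    rw [← integral_finset_sum _ fun k _ => hTi k, hVi]
    have e : ∀ x, (fstar x - c) ^ 2 = (∑ k, (f k (x k) - w k) * Z x) + (∑ k, w k - c) * Z x := by
      intro x
      rw [← Finset.sum_mul, Finset.sum_sub_distrib, ← hadd]
      simp only [hZ]; ring
    simp only [e]
    rw [integral_add (integrable_finset_sum _ fun k _ => hTi k) (hZi.const_mul _), integral_const_mul, hZ0]
    ring
  set D := ∑ k, (∫ x in E k, (f k x - w k) ^ 2) / (volume (E k)).toReal with hD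
  have hDV : θlo * (D * vA) ≤ V := by
    have hY : ∀ x : Fin p → ℝ, ∑ k, f k (x k) - c = fstar x - c := fun x => by rw [hadd]
    simp only [hY] at hw
    have h1 : ∫ x, (fstar x - c) ^ 2 ∂(ENNReal.ofReal θlo • volume.restrict A) ≤ V := by
      rw [hVi]
      exact integral_mono_measure hloA (Eventually.of_forall fun _ => sq_nonneg _)
        (sid_bdd_sq_int _ fstar hfsm _ hfsB c)
    rw [integral_smul_measure, ENNReal.toReal_ofReal hθlo.le, smul_eq_mul] at h1
    refine le_trans ?_ h1
    gcongr
  have hV2 : V ^ 2 ≤ p * (2 * (1 + β) ^ 2 * S * N * M * D) := by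
    calc V ^ 2 ≤ p * ∑ k, (∫ x in A, (f k (x k) - w k) * Z x ∂μ) ^ 2 := by
          rw [hVsum]
          simpa using sq_sum_le_card_mul_sum_sq (s := Finset.univ)
            (f := fun k => ∫ x in A, (f k (x k) - w k) * Z x ∂μ)
      _ ≤ p * ∑ k, 2 * (1 + β) ^ 2 * S * N * M * ((∫ x in E k, (f k x - w k) ^ 2) / (volume (E k)).toReal) := by
          gcongr with k _
          exact hcoord k
      _ = _ := by rw [← Finset.mul_sum]
  have hD0 : 0 ≤ D := Finset.sum_nonneg fun k _ =>
    div_nonneg (integral_nonneg fun _ => sq_nonneg _) ENNReal.toReal_nonneg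
  have hCβ : 2 * (1 + β) ^ 2 ≤ C := by
    refine le_trans ?_ (le_max_left _ _)
    nlinarith
  have hfinal : V ^ 2 * θlo ≤ (p * C * S * M * θhi) * V := by
    calc V ^ 2 * θlo ≤ (p * (2 * (1 + β) ^ 2 * S * N * M * D)) * θlo := by gcongr
      _ ≤ (p * (C * S * (θhi * vA) * M * D)) * θlo := by gcongr
      _ = (p * C * S * M * θhi) * (θlo * (D * vA)) := by ring
      _ ≤ _ := by gcongr
  have hfin2 : V * θlo ≤ p * C * S * M * θhi := by
    refine le_of_mul_le_mul_right ?_ hVpos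
    linarith
  rw [div_mul_eq_mul_div, div_le_iff₀ (by positivity)]
  linarith

lemma sid_bdd_piece (f : ℝ → ℝ) (a b : ℝ) (hab : a < b) (hc : ContinuousOn f (Ioo a b))
    (h1 : ∃ L : ℝ, Tendsto f (nhdsWithin a (Ioi a)) (nhds L))
    (h2 : ∃ L : ℝ, Tendsto f (nhdsWithin b (Iio b)) (nhds L)) :
    ∃ B : ℝ, ∀ x ∈ Ioo a b, |f x| ≤ B := by
  obtain ⟨L1, h1⟩ := h1
  obtain ⟨L2, h2⟩ := h2
  have hcc := continuousOn_Icc_extendFrom_Ioo hc h1 h2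
  obtain ⟨B, hB⟩ := isCompact_Icc.exists_bound_of_continuousOn hcc
  refine ⟨B, fun x hx => ?_⟩
  have h := hB x (Ioo_subset_Icc_self hx)
  have he : extendFrom (Ioo a b) f x = f x :=
    extendFrom_eq (subset_closure hx) (hc x hx)
  rw [he] at h
  simpa using h

lemma sid_condMean_congr {p : ℕ} (μ : Measure (Fin p → ℝ)) (f g : (Fin p → ℝ) → ℝ)
    (h : f =ᵐ[μ] g) (A : Set (Fin p → ℝ)) : condMean μ f A = condMean μ g A := by
  unfold condMean
  rw [integral_congr_ae (ae_restrict_of_ae h)]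

lemma sid_condVar_congr {p : ℕ} (μ : Measure (Fin p → ℝ)) (f g : (Fin p → ℝ) → ℝ)
    (h : f =ᵐ[μ] g) (A : Set (Fin p → ℝ)) : condVar μ f A = condVar μ g A := by
  unfold condVar
  rw [sid_condMean_congr μ f g h A]
  congr 1
  refine integral_congr_ae (ae_restrict_of_ae ?_)
  filter_upwards [h] with x hx
  rw [hx]

lemma sid_impurity_congr {p : ℕ} (μ : Measure (Fin p → ℝ)) (f g : (Fin p → ℝ) → ℝ)
    (h : f =ᵐ[μ] g) (A : Set (Fin p → ℝ)) (j : Fin p) (b : ℝ) :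
    impurity μ f A j b = impurity μ g A j b := by
  unfold impurity
  simp only [sid_condVar_congr μ f g h]


/-- **Proposition (SID from additive piecewise-LRP components).**
If each component `f_k` of the additive signal is, on each piece `(t^{(k)}_{j-1}, t^{(k)}_j)`
of a partition of `[0,1]` into `r` pieces of length at least `α/r`, differentiable with
one-sided limits at the knots and in `LRP((t_{j-1}, t_j), β)`, then the SID condition holds
with `λ = θlo/(p θhi τ²)` where
`τ² = max{2rθhi/θlo, r²/(2α)} · max{9β², 32+β²}`. -/
theorem sid_of_additive_piecewise_lrp
    (p r : ℕ) (hp : 1 ≤ p) (hr : 1 ≤ r)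
    (α β : ℝ) (hα : 0 < α) (hβ : 1 ≤ β)
    (μ : Measure (Fin p → ℝ)) [IsProbabilityMeasure μ]
    (pX : (Fin p → ℝ) → ℝ) (θlo θhi : ℝ)
    (hθlo : 0 < θlo) (hθlo1 : θlo ≤ 1) (hθhi1 : 1 ≤ θhi)
    (hdens : μ = (volume.restrict (box p)).withDensity fun u => ENNReal.ofReal (pX u))
    (hbound : ∀ u ∈ box p, θlo ≤ pX u ∧ pX u ≤ θhi)
    (f : Fin p → ℝ → ℝ) (f' : Fin p → ℝ → ℝ)
    (t : Fin p → ℕ → ℝ)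
    (ht0 : ∀ k, t k 0 = 0) (htr : ∀ k, t k r = 1)
    (hgap : ∀ k, ∀ j < r, α / r ≤ t k (j + 1) - t k j)
    (hmono : ∀ k, ∀ j < r, t k j < t k (j + 1))
    (hderiv : ∀ k, ∀ j < r, ∀ s ∈ Set.Ioo (t k j) (t k (j + 1)), HasDerivAt (f k) (f' k s) s)
    (hlimL : ∀ k, ∀ j : ℕ, 1 ≤ j → j ≤ r →
      ∃ L : ℝ, Tendsto (f k) (nhdsWithin (t k j) (Set.Iio (t k j))) (nhds L))
    (hlimR : ∀ k, ∀ j < r,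
      ∃ L : ℝ, Tendsto (f k) (nhdsWithin (t k j) (Set.Ioi (t k j))) (nhds L))
    (hLRP : ∀ k, ∀ j < r, LRPOn (f k) (f' k) (Set.Ioo (t k j) (t k (j + 1))) β)
    (fstar : (Fin p → ℝ) → ℝ)
    (hadd : ∀ u, fstar u = ∑ k, f k (u k)) :
    ∀ E : Fin p → Set ℝ, (∀ j, (E j).OrdConnected) → (∀ j, E j ⊆ Set.Icc (0 : ℝ) 1) →
      (⨆ j : Fin p, ⨆ b : ℝ, impurity μ fstar (Set.univ.pi E) j b) ≥
        θlo / (p * θhi *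
            (max (2 * r * θhi / θlo) (r ^ 2 / (2 * α)) * max (9 * β ^ 2) (32 + β ^ 2))) *
          (μ (Set.univ.pi E)).toReal * condVar μ fstar (Set.univ.pi E) := by
  intro E hEo hEs
  have hboxm : MeasurableSet (box p) := MeasurableSet.univ_pi fun _ => measurableSet_Icc
  have hμlo : ENNReal.ofReal θlo • volume.restrict (box p) ≤ μ := by
    rw [hdens, ← withDensity_const]
    refine withDensity_mono ?_
    filter_upwards [ae_restrict_mem hboxm] with u hu
    exact ENNReal.ofReal_le_ofReal (hbound u hu).1
  have hμhi : μ ≤ ENNReal.ofReal θhi • volume.restrict (box p) := by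
    rw [hdens, ← withDensity_const]
    refine withDensity_mono ?_
    filter_upwards [ae_restrict_mem hboxm] with u hu
    exact ENNReal.ofReal_le_ofReal (hbound u hu).2
  let U : Fin p → Set ℝ := fun k => ⋃ j ∈ Finset.range r, Ioo (t k j) (t k (j + 1))
  have hUmem : ∀ k, ∀ j < r, Ioo (t k j) (t k (j + 1)) ⊆ U k := by
    intro k j hj x hx
    exact mem_biUnion (Finset.mem_coe.2 (Finset.mem_range.2 hj)) hx
  have hUex : ∀ k, ∀ x ∈ U k, ∃ j < r, x ∈ Ioo (t k j) (t k (j + 1)) := by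
    intro k x hx
    simp only [U, mem_iUnion, Finset.mem_range] at hx
    obtain ⟨j, hj, h⟩ := hx
    exact ⟨j, hj, h⟩
  have hUo : ∀ k, IsOpen (U k) := fun k => isOpen_biUnion fun _ _ => isOpen_Ioo
  have hUc : ∀ k, ContinuousOn (f k) (U k) := by
    intro k x hx
    obtain ⟨j, hj, h⟩ := hUex k x hx
    exact (hderiv k j hj x h).continuousAt.continuousWithinAt
  let g : Fin p → ℝ → ℝ := fun k => (U k).piecewise (f k) (fun _ => 0)
  have hgU : ∀ k, ∀ x ∈ U k, g k x = f k x := fun k x hx => Set.piecewise_eq_of_mem _ _ _ hx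
  have hgm : ∀ k, Measurable (g k) := fun k =>
    (hUc k).measurable_piecewise continuousOn_const (hUo k).measurableSet
  have hgB : ∃ B : ℝ, ∀ k x, |g k x| ≤ B := by
    have h1 : ∀ k : Fin p, ∀ j : ℕ, ∃ B : ℝ, j < r → ∀ x ∈ Ioo (t k j) (t k (j + 1)), |f k x| ≤ B := by
      intro k j
      by_cases hj : j < r
      · obtain ⟨B, hB⟩ := sid_bdd_piece (f k) (t k j) (t k (j + 1)) (hmono k j hj)
          ((hUc k).mono (hUmem k j hj)) (hlimR k j hj) (hlimL k (j + 1) (by omega) (by omega))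
        exact ⟨B, fun _ => hB⟩
      · exact ⟨0, fun h => absurd h hj⟩
    choose B hB using h1
    refine ⟨∑ k, ∑ j ∈ Finset.range r, |B k j|, fun k x => ?_⟩
    by_cases hx : x ∈ U k
    · rw [hgU k x hx]
      obtain ⟨j, hj, h⟩ := hUex k x hx
      calc |f k x| ≤ B k j := hB k j hj x h
        _ ≤ |B k j| := le_abs_self _
        _ ≤ ∑ j ∈ Finset.range r, |B k j| :=
            Finset.single_le_sum (f := fun j => |B k j|) (fun i _ => abs_nonneg _) (Finset.mem_range.2 hj)
        _ ≤ _ := Finset.single_le_sum (f := fun k => ∑ j ∈ Finset.range r, |B k j|)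
            (fun i _ => Finset.sum_nonneg fun _ _ => abs_nonneg _) (Finset.mem_univ k)
    · have : g k x = 0 := Set.piecewise_eq_of_notMem _ _ _ hx
      rw [this, abs_zero]
      exact Finset.sum_nonneg fun _ _ => Finset.sum_nonneg fun _ _ => abs_nonneg _
  obtain ⟨B, hB⟩ := hgB
  have hgd : ∀ k, ∀ j < r, ∀ s ∈ Set.Ioo (t k j) (t k (j + 1)), HasDerivAt (g k) (f' k s) s := by
    intro k j hj s hs
    refine (hderiv k j hj s hs).congr_of_eventuallyEq ?_
    filter_upwards [(hUo k).mem_nhds (hUmem k j hj hs)] with x hx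
    exact hgU k x hx
  have hL : ∀ k, ∀ j < r, ∀ c d, c < d → Icc c d ⊆ Ioo (t k j) (t k (j + 1)) → ∀ w : ℝ,
      (∫ t in c..d, |deriv (g k) t|) ^ 2 ≤ β ^ 2 / (d - c) * ∫ t in c..d, (g k t - w) ^ 2 := by
    intro k j hj c d hcd hsub w
    have h1 : ∫ t in c..d, |deriv (g k) t| = ∫ t in c..d, |f' k t| := by
      refine intervalIntegral.integral_congr fun x hx => ?_
      rw [uIcc_of_le hcd.le] at hx
      simp only [(hgd k j hj x (hsub hx)).deriv]
    have h2 : ∫ t in c..d, (g k t - w) ^ 2 = ∫ t in c..d, |f k t - w| ^ 2 := by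
      refine intervalIntegral.integral_congr fun x hx => ?_
      rw [uIcc_of_le hcd.le] at hx
      simp only [hgU k x (hUmem k j hj (hsub hx)), sq_abs]
    rw [h1, h2]
    refine (hLRP k j hj c d hcd hsub).trans ?_
    refine mul_le_mul_of_nonneg_left ?_ (div_nonneg (sq_nonneg _) (by linarith))
    refine ciInf_le ⟨0, ?_⟩ w
    rintro _ ⟨v, rfl⟩
    exact intervalIntegral.integral_nonneg hcd.le fun _ _ => sq_nonneg _
  have hae : fstar =ᵐ[μ] fun u => ∑ k, g k (u k) := by
    have hac : μ ≪ (volume.restrict (box p)) :=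
      (Measure.absolutelyContinuous_of_le hμhi).trans Measure.smul_absolutelyContinuous
    have hne : ∀ᵐ x : Fin p → ℝ, ∀ k : Fin p, ∀ j : ℕ, x k ≠ t k j := by
      rw [ae_all_iff]; intro k
      rw [ae_all_iff]; intro j
      rw [ae_iff]
      simp only [ne_eq, not_not]
      exact Measure.pi_hyperplane (fun _ : Fin p => (volume : Measure ℝ)) k (t k j)
    have h3 : ∀ᵐ x ∂(volume.restrict (box p)), fstar x = ∑ k, g k (x k) := by
      filter_upwards [ae_restrict_mem hboxm, ae_restrict_of_ae hne] with x hx hx2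
      rw [hadd]
      refine Finset.sum_congr rfl fun k _ => ?_
      have hxk : x k ∈ Icc (0 : ℝ) 1 := hx k (mem_univ k)
      obtain ⟨j, hj, h⟩ := sid_knots_cover r (t k) (x k) (by rw [ht0]; exact hxk.1)
        (by rw [htr]; exact hxk.2) (fun j _ => hx2 k j)
      exact (hgU k _ (hUmem k j hj h)).symm
    exact hac.ae_le h3
  simp only [sid_condVar_congr μ _ _ hae, sid_impurity_congr μ _ _ hae]
  exact sid_core p r hp hr α β hα hβ μ θlo θhi hθlo (by linarith) hμlo hμhi g hgm B hB t ht0 htr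
    hgap hmono (fun k j hj s hs => (hgd k j hj s hs).differentiableAt) hL _ (fun _ => rfl) E hEo hEs
end
end

section
/- Let p ≥ 1 and let μ be a probability measure on [0,1]^p having a density p_X with respect to Lebesgue measure with 0 < θ̲ ≤ p_X(u) ≤ θ̄ < ∞ for all u ∈ [0,1]^p, where θ̲ ≤ 1 ≤ θ̄; let X ~ μ. Suppose f*(u) = f*_1(u_1) + ⋯ + f*_p(u_p) with each f*_k differentiable on [0,1] with integrable derivative. For a rectangle A = ∏_{j=1}^p [ℓ_j, u_j] ⊆ [0,1]^p with ℓ_j < u_j for all j, and k ∈ {1,…,p}, define q_A^{(k)}(t) := P(X^{(k)} ≤ t | X ∈ A), where X^{(k)} is the k-th coordinate of X. Suppose there is τ > 0 such that for every such rectangle A and every k, (∫_{ℓ_k}^{u_k} √(q_A^{(k)}(t)(1 − q_A^{(k)}(t))) · |f*_k'(t)| dt)² ≤ (τ²/(u_k − ℓ_k)) · inf_{w ∈ ℝ} ∫_{ℓ_k}^{u_k} |f*_k(t) − w|² dt. Then for every rectangle A ⊆ [0,1]^p, sup_{j ∈ {1,…,p}, b ∈ ℝ} Δ(A, j, b) ≥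 (θ̲/(p τ² θ̄)) · P(X ∈ A) · Var(f*(X) | X ∈ A). -/
open MeasureTheory Set Filter
open scoped ENNReal Classical

noncomputable section

/-- The closed rectangle `∏_j [ℓ_j, u_j]`. -/
def rect {p : ℕ} (ℓ u : Fin p → ℝ) : Set (Fin p → ℝ) :=
  Set.univ.pi fun j => Set.Icc (ℓ j) (u j)

/-- Conditional CDF of the `k`-th coordinate given `X ∈ A`:
`q_A^{(k)}(s) = P(X^{(k)} ≤ s | X ∈ A)`. -/
def condCDFCoord {p : ℕ} (μ : Measure (Fin p → ℝ)) (A : Set (Fin p → ℝ)) (k : Fin p)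
    (s : ℝ) : ℝ :=
  (μ (A ∩ {v | v k ≤ s})).toReal / (μ A).toReal

lemma aux_rect_meas {p : ℕ} (ℓ u : Fin p → ℝ) : MeasurableSet (rect ℓ u) :=
  MeasurableSet.univ_pi fun _ => measurableSet_Icc

lemma aux_rect_compact {p : ℕ} (ℓ u : Fin p → ℝ) : IsCompact (rect ℓ u) :=
  isCompact_univ_pi fun _ => isCompact_Icc

lemma aux_condVar_nonneg {p : ℕ} (μ : Measure (Fin p → ℝ)) (f : (Fin p → ℝ) → ℝ)
    (A : Set (Fin p → ℝ)) : 0 ≤ condVar μ f A := by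
  unfold condVar
  exact div_nonneg (integral_nonneg fun x => sq_nonneg _) ENNReal.toReal_nonneg

lemma aux_int_sq {p : ℕ} (μ : Measure (Fin p → ℝ)) [IsFiniteMeasure μ]
    (f : (Fin p → ℝ) → ℝ) (B : Set (Fin p → ℝ))
    (h1 : IntegrableOn f B μ) (h2 : IntegrableOn (fun x => f x ^ 2) B μ) (c : ℝ) :
    IntegrableOn (fun x => (f x - c) ^ 2) B μ := by
  have : (fun x => (f x - c) ^ 2) = fun x => f x ^ 2 - 2 * c * f x + c ^ 2 := by
    ext x; ring
  rw [this]
  exact (h2.sub (h1.const_mul _)).add (integrable_const _)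

lemma aux_expand {p : ℕ} (μ : Measure (Fin p → ℝ)) [IsFiniteMeasure μ]
    (f : (Fin p → ℝ) → ℝ) (B : Set (Fin p → ℝ))
    (h1 : IntegrableOn f B μ) (h2 : IntegrableOn (fun x => f x ^ 2) B μ) (c : ℝ) :
    ∫ x in B, (f x - c) ^ 2 ∂μ =
      (∫ x in B, f x ^ 2 ∂μ) - 2 * c * (∫ x in B, f x ∂μ) + c ^ 2 * (μ B).toReal := by
  have : (fun x => (f x - c) ^ 2) = fun x => f x ^ 2 - 2 * c * f x + c ^ 2 := by
    ext x; ring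
  have hs : Integrable (fun x => f x ^ 2 - 2 * c * f x) (μ.restrict B) :=
    Integrable.sub h2 (Integrable.const_mul h1 _)
  rw [this, integral_add hs (integrable_const _), integral_sub h2 (h1.const_mul _), integral_const_mul]
  simp [Measure.real]; ring

lemma aux_lin {p : ℕ} (μ : Measure (Fin p → ℝ)) [IsFiniteMeasure μ]
    (f : (Fin p → ℝ) → ℝ) (B : Set (Fin p → ℝ))
    (h1 : IntegrableOn f B μ) (c : ℝ) :
    ∫ x in B, (f x - c) ∂μ = (∫ x in B, f x ∂μ) - c * (μ B).toReal := by
  rw [integral_sub h1 (integrable_const _)]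
  simp [Measure.real]; ring

lemma aux_S {p : ℕ} (μ : Measure (Fin p → ℝ)) [IsFiniteMeasure μ]
    (f : (Fin p → ℝ) → ℝ) (B : Set (Fin p → ℝ))
    (h1 : IntegrableOn f B μ) (h2 : IntegrableOn (fun x => f x ^ 2) B μ) (c : ℝ) :
    (μ B).toReal * condVar μ f B =
      (∫ x in B, (f x - c) ^ 2 ∂μ) - (∫ x in B, (f x - c) ∂μ) ^ 2 / (μ B).toReal := by
  unfold condVar condMean
  rw [aux_expand μ f B h1 h2, aux_expand μ f B h1 h2, aux_lin μ f B h1]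
  by_cases h : (μ B).toReal = 0
  · have h0 : μ B = 0 := by
      rcases (ENNReal.toReal_eq_zero_iff _).1 h with h | h
      · exact h
      · exact absurd h (measure_ne_top _ _)
    simp [h0, Measure.restrict_eq_zero.2 h0]
  · field_simp
    ring

lemma aux_cellL_union {p : ℕ} (A : Set (Fin p → ℝ)) (j : Fin p) (b : ℝ) :
    cellL A j b ∪ cellR A j b = A := by
  ext x; simp only [cellL, cellR, mem_union, mem_inter_iff, mem_ofPred_eq]
  have := le_or_gt (x j) b
  tauto

lemma aux_cell_disj {p : ℕ} (A : Set (Fin p → ℝ)) (j : Fin p) (b : ℝ) :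
    Disjoint (cellL A j b) (cellR A j b) := by
  rw [Set.disjoint_left]
  rintro x ⟨_, h1⟩ ⟨_, h2⟩
  simp only [mem_ofPred_eq] at h1 h2
  linarith

lemma aux_cellL_meas {p : ℕ} (A : Set (Fin p → ℝ)) (hA : MeasurableSet A) (j : Fin p) (b : ℝ) :
    MeasurableSet (cellL A j b) :=
  hA.inter (measurableSet_le (measurable_pi_apply j) measurable_const)

lemma aux_cellR_meas {p : ℕ} (A : Set (Fin p → ℝ)) (hA : MeasurableSet A) (j : Fin p) (b : ℝ) :
    MeasurableSet (cellR A j b) :=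
  hA.inter (measurableSet_lt measurable_const (measurable_pi_apply j))

/-- The key bound on the partial integral. -/
lemma aux_G {p : ℕ} (μ : Measure (Fin p → ℝ)) [IsFiniteMeasure μ]
    (f : (Fin p → ℝ) → ℝ) (A : Set (Fin p → ℝ)) (hA : MeasurableSet A)
    (hP : 0 < (μ A).toReal)
    (h1 : IntegrableOn f A μ) (h2 : IntegrableOn (fun x => f x ^ 2) A μ) (j : Fin p) (b : ℝ) :
    (∫ x in cellL A j b, (f x - condMean μ f A) ∂μ) ^ 2 =
      impurity μ f A j b * (μ A).toReal *
        (condCDFCoord μ A j b * (1 - condCDFCoord μ A j b)) := by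
  set m := condMean μ f A with hm
  have hLA : cellL A j b ⊆ A := inter_subset_left
  have hRA : cellR A j b ⊆ A := inter_subset_left
  have hF1 : IntegrableOn (fun x => f x - m) A μ := h1.sub (integrable_const _)
  have hF2 := aux_int_sq μ f A h1 h2 m
  have hmA : (∫ x in A, (f x - m) ∂μ) = 0 := by
    rw [aux_lin μ f A h1, hm, condMean]; field_simp; ring
  have e1 : (∫ x in A, (f x - m) ∂μ) =
      (∫ x in cellL A j b, (f x - m) ∂μ) + ∫ x in cellR A j b, (f x - m) ∂μ := by
    conv_lhs => rw [← aux_cellL_union A j b]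
    exact setIntegral_union (aux_cell_disj A j b) (aux_cellR_meas A hA j b)
      (hF1.mono_set hLA) (hF1.mono_set hRA)
  have e2 : (∫ x in A, (f x - m) ^ 2 ∂μ) =
      (∫ x in cellL A j b, (f x - m) ^ 2 ∂μ) + ∫ x in cellR A j b, (f x - m) ^ 2 ∂μ := by
    conv_lhs => rw [← aux_cellL_union A j b]
    exact setIntegral_union (aux_cell_disj A j b) (aux_cellR_meas A hA j b)
      (hF2.mono_set hLA) (hF2.mono_set hRA)
  have e3 : (μ A).toReal = (μ (cellL A j b)).toReal + (μ (cellR A j b)).toReal := by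
    rw [← ENNReal.toReal_add (measure_ne_top _ _) (measure_ne_top _ _),
      ← measure_union (aux_cell_disj A j b) (aux_cellR_meas A hA j b), aux_cellL_union]
  have hq : condCDFCoord μ A j b = (μ (cellL A j b)).toReal / (μ A).toReal := rfl
  have zL : (μ (cellL A j b)).toReal = 0 → ∫ x in cellL A j b, (f x - m) ∂μ = 0 := by
    intro h
    rcases (ENNReal.toReal_eq_zero_iff _).1 h with h | h
    · simp [Measure.restrict_eq_zero.2 h]
    · exact absurd h (measure_ne_top _ _)
  have zR : (μ (cellR A j b)).toReal = 0 → ∫ x in cellR A j b, (f x - m) ∂μ = 0 := by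
    intro h
    rcases (ENNReal.toReal_eq_zero_iff _).1 h with h | h
    · simp [Measure.restrict_eq_zero.2 h]
    · exact absurd h (measure_ne_top _ _)
  unfold impurity
  rw [hq, aux_S μ f A h1 h2 m, aux_S μ f _ (h1.mono_set hLA) (h2.mono_set hLA) m,
    aux_S μ f _ (h1.mono_set hRA) (h2.mono_set hRA) m, hmA, e2]
  rw [hmA] at e1
  have e1' : (∫ x in cellR A j b, (f x - m) ∂μ) = - ∫ x in cellL A j b, (f x - m) ∂μ := by
    linarith
  rw [e1'] at zR ⊢
  generalize (∫ x in cellL A j b, (f x - m) ∂μ) = G at *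
  generalize (μ (cellL A j b)).toReal = L at *
  generalize (μ (cellR A j b)).toReal = R at *
  by_cases hL : L = 0
  · simp [zL hL, hL]
  by_cases hR : R = 0
  · have := zR hR
    have : G = 0 := by linarith
    simp [this]
  have h1q : 1 - L / (μ A).toReal = R / (μ A).toReal := by
    rw [e3] at hP ⊢; field_simp; ring
  rw [h1q, e3]
  rw [e3] at hP
  have := hP.ne'
  field_simp
  ring

lemma aux_imp_le {p : ℕ} (μ : Measure (Fin p → ℝ)) 
    (f : (Fin p → ℝ) → ℝ) (A : Set (Fin p → ℝ)) (j : Fin p) (b : ℝ) :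
    impurity μ f A j b ≤ (μ A).toReal * condVar μ f A := by
  unfold impurity
  have h1 := mul_nonneg (ENNReal.toReal_nonneg (a := μ (cellL A j b)))
    (aux_condVar_nonneg μ f (cellL A j b))
  have h2 := mul_nonneg (ENNReal.toReal_nonneg (a := μ (cellR A j b)))
    (aux_condVar_nonneg μ f (cellR A j b))
  linarith

lemma aux_le_sup {p : ℕ} (μ : Measure (Fin p → ℝ)) 
    (f : (Fin p → ℝ) → ℝ) (A : Set (Fin p → ℝ)) (j : Fin p) (b : ℝ) :
    impurity μ f A j b ≤ ⨆ j : Fin p, ⨆ b : ℝ, impurity μ f A j b := by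
  have h1 : ∀ j, BddAbove (range fun b => impurity μ f A j b) := fun j =>
    ⟨(μ A).toReal * condVar μ f A, by rintro _ ⟨b, rfl⟩; exact aux_imp_le μ f A j b⟩
  exact (le_ciSup (h1 j) b).trans
    (le_ciSup (f := fun j => ⨆ b : ℝ, impurity μ f A j b) (Set.finite_range _).bddAbove j)

lemma aux_dens {p : ℕ} (pX : (Fin p → ℝ) → ℝ) (θlo θhi : ℝ) (μ : Measure (Fin p → ℝ))
    (hdens : μ = (volume.restrict (box p)).withDensity fun u => ENNReal.ofReal (pX u))
    (hbound : ∀ u ∈ box p, θlo ≤ pX u ∧ pX u ≤ θhi) (A : Set (Fin p → ℝ))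
    (hA : MeasurableSet A) (hAb : A ⊆ box p) :
    ENNReal.ofReal θlo • volume.restrict A ≤ μ.restrict A ∧
      μ.restrict A ≤ ENNReal.ofReal θhi • volume.restrict A := by
  have key : ∀ s, MeasurableSet s → μ.restrict A s =
      ∫⁻ x in s ∩ A, ENNReal.ofReal (pX x) := by
    intro s hs
    rw [Measure.restrict_apply hs, hdens, withDensity_apply _ (hs.inter hA),
      Measure.restrict_restrict (hs.inter hA),
      inter_eq_left.2 (inter_subset_right.trans hAb)]
  constructor
  · rw [Measure.le_iff]
    intro s hs
    rw [key s hs, Measure.smul_apply, Measure.restrict_apply hs, smul_eq_mul,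
      ← setLIntegral_const]
    exact setLIntegral_mono' (hs.inter hA) fun x hx =>
      ENNReal.ofReal_le_ofReal (hbound x (hAb hx.2)).1
  · rw [Measure.le_iff]
    intro s hs
    rw [key s hs, Measure.smul_apply, Measure.restrict_apply hs, smul_eq_mul,
      ← setLIntegral_const]
    exact setLIntegral_mono' (hs.inter hA) fun x hx =>
      ENNReal.ofReal_le_ofReal (hbound x (hAb hx.2)).2

lemma aux_fub {p : ℕ} (μ : Measure (Fin p → ℝ)) [IsFiniteMeasure μ] (ℓ u : Fin p → ℝ)
    (F : (Fin p → ℝ) → ℝ) (hF : ContinuousOn F (rect ℓ u))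
    (hF0 : ∫ x in rect ℓ u, F x ∂μ = 0) (k : Fin p) (g g' : ℝ → ℝ)
    (hg : ContinuousOn g (Icc (ℓ k) (u k)))
    (hd : ∀ s ∈ Ioo (ℓ k) (u k), HasDerivAt g (g' s) s)
    (hi : IntegrableOn g' (Icc (ℓ k) (u k)) volume) :
    ∫ x in rect ℓ u, F x * g (x k) ∂μ =
      - ∫ t in Icc (ℓ k) (u k), g' t * ∫ x in cellL (rect ℓ u) k t, F x ∂μ := by
  set A := rect ℓ u with hAdef
  have hA : MeasurableSet A := aux_rect_meas ℓ u
  have hFi : IntegrableOn F A μ := hF.integrableOn_compact (aux_rect_compact ℓ u)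
  have hset : MeasurableSet {z : (Fin p → ℝ) × ℝ | z.1 k ≤ z.2} :=
    measurableSet_le ((measurable_pi_apply k).comp measurable_fst) measurable_snd
  have hint : Integrable (fun z : (Fin p → ℝ) × ℝ =>
      ({z : (Fin p → ℝ) × ℝ | z.1 k ≤ z.2}).indicator (fun z => F z.1 * g' z.2) z)
      ((μ.restrict A).prod (volume.restrict (Icc (ℓ k) (u k)))) :=
    (Integrable.mul_prod hFi hi).indicator hset
  have hswap := integral_integral_swap (f := fun x t =>
    ({z : (Fin p → ℝ) × ℝ | z.1 k ≤ z.2}).indicator (fun z => F z.1 * g' z.2) (x, t)) hint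
  have hin : ∀ x ∈ A, (∫ t in Icc (ℓ k) (u k),
      ({z : (Fin p → ℝ) × ℝ | z.1 k ≤ z.2}).indicator (fun z => F z.1 * g' z.2) (x, t))
        = F x * g (u k) - F x * g (x k) := by
    intro x hx
    have hxk : x k ∈ Icc (ℓ k) (u k) := hx k (mem_univ k)
    have e : ∀ t, ({z : (Fin p → ℝ) × ℝ | z.1 k ≤ z.2}).indicator
        (fun z => F z.1 * g' z.2) (x, t) = F x * (Ici (x k)).indicator g' t := by
      intro t
      by_cases h : x k ≤ t
      · simp [Set.indicator, h]
      · simp [Set.indicator, h]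
    simp_rw [e]
    rw [integral_const_mul, setIntegral_indicator measurableSet_Ici]
    have : Icc (ℓ k) (u k) ∩ Ici (x k) = Icc (x k) (u k) := by
      ext t; simp only [mem_inter_iff, mem_Icc, mem_Ici]
      have := hxk.1
      constructor
      · rintro ⟨⟨_, h⟩, h'⟩; exact ⟨h', h⟩
      · rintro ⟨h, h'⟩; exact ⟨⟨by linarith, h'⟩, h⟩
    have hsub : Icc (x k) (u k) ⊆ Icc (ℓ k) (u k) := Icc_subset_Icc_left hxk.1
    rw [this, integral_Icc_eq_integral_Ioc, ← intervalIntegral.integral_of_le hxk.2,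
      intervalIntegral.integral_eq_sub_of_hasDerivAt_of_le hxk.2 (hg.mono hsub)
        (fun s hs => hd s ⟨by linarith [hs.1, hxk.1], hs.2⟩)
        ((intervalIntegrable_iff_integrableOn_Icc_of_le hxk.2).2 (hi.mono_set hsub))]
    ring
  have hout : ∀ t, (∫ x in A,
      ({z : (Fin p → ℝ) × ℝ | z.1 k ≤ z.2}).indicator (fun z => F z.1 * g' z.2) (x, t) ∂μ)
        = g' t * ∫ x in cellL A k t, F x ∂μ := by
    intro t
    have e : ∀ x, ({z : (Fin p → ℝ) × ℝ | z.1 k ≤ z.2}).indicator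
        (fun z => F z.1 * g' z.2) (x, t) = g' t * ({v : Fin p → ℝ | v k ≤ t}).indicator F x := by
      intro x
      by_cases h : x k ≤ t
      · simp [Set.indicator, h, mul_comm]
      · simp [Set.indicator, h]
    simp_rw [e]
    rw [integral_const_mul,
      setIntegral_indicator (measurableSet_le (measurable_pi_apply k) measurable_const)]
    rfl
  simp_rw [hout] at hswap
  rw [setIntegral_congr_fun hA hin] at hswap
  have hgA : ContinuousOn (fun x : Fin p → ℝ => g (x k)) A :=
    hg.comp (continuous_apply k).continuousOn fun x hx => hx k (mem_univ k)
  have hFg : IntegrableOn (fun x => F x * g (x k)) A μ :=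
    (hF.mul hgA).integrableOn_compact (aux_rect_compact ℓ u)
  rw [integral_sub (hFi.mul_const _) hFg, integral_mul_const, hF0] at hswap
  linarith

lemma aux_pi {p : ℕ} (ℓ u : Fin p → ℝ) (hlu : ∀ j, ℓ j < u j) :
    Measure.pi (fun k => (ENNReal.ofReal (u k - ℓ k))⁻¹ • volume.restrict (Icc (ℓ k) (u k))) =
      (volume (rect ℓ u))⁻¹ • (volume.restrict (rect ℓ u) : Measure (Fin p → ℝ)) := by
  have hfin : ∀ k, (ENNReal.ofReal (u k - ℓ k))⁻¹ ≠ ∞ := fun k => by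
    simp [hlu k]
  have : ∀ k, IsFiniteMeasure ((ENNReal.ofReal (u k - ℓ k))⁻¹ •
      (volume.restrict (Icc (ℓ k) (u k)) : Measure ℝ)) := fun k =>
    Measure.smul_finite _ (hfin k)
  symm
  refine (Measure.pi_eq fun s hs => ?_).symm
  have : (volume.restrict (rect ℓ u) : Measure (Fin p → ℝ)) =
      Measure.pi fun k => volume.restrict (Icc (ℓ k) (u k)) := by
    rw [volume_pi, rect, Measure.restrict_pi_pi]
  rw [this, Measure.smul_apply, Measure.pi_pi, rect, volume_pi_pi]
  simp only [Real.volume_Icc, Measure.smul_apply, smul_eq_mul]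
  rw [Finset.prod_mul_distrib, ENNReal.prod_inv_distrib]
  intro i _ j _ _
  right; simp

open ProbabilityTheory in
lemma aux_unif {p : ℕ} (ℓ u : Fin p → ℝ) (hlu : ∀ j, ℓ j < u j) (f : Fin p → ℝ → ℝ)
    (hf : ∀ k, ContinuousOn (f k) (Icc (ℓ k) (u k))) (m : ℝ) :
    ∑ k, (1 / (u k - ℓ k)) * ⨅ w : ℝ, ∫ s in ℓ k..u k, |f k s - w| ^ 2 ≤
      (volume (rect ℓ u)).toReal⁻¹ * ∫ x in rect ℓ u, (∑ k, f k (x k) - m) ^ 2 := by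
  have hfin : ∀ k, (ENNReal.ofReal (u k - ℓ k))⁻¹ ≠ ∞ := fun k => by
    simp [hlu k]
  let ν : Fin p → Measure ℝ := fun k =>
    (ENNReal.ofReal (u k - ℓ k))⁻¹ • volume.restrict (Icc (ℓ k) (u k))
  have hprob : ∀ k, IsProbabilityMeasure (ν k) := fun k => by
    constructor
    simp only [ν, Measure.smul_apply, Measure.restrict_apply_univ, Real.volume_Icc, smul_eq_mul]
    exact ENNReal.inv_mul_cancel (by simp [hlu k]) (by simp)
  have hpi : Measure.pi ν = _ := aux_pi ℓ u hlu
  have hmem : ∀ k, MemLp (f k) 2 (ν k) := fun k => by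
    refine MemLp.smul_measure ?_ (hfin k)
    obtain ⟨C, hC⟩ := (isCompact_Icc.image_of_continuousOn (hf k)).isBounded.exists_norm_le
    refine MemLp.of_bound ((hf k).aestronglyMeasurable measurableSet_Icc) C ?_
    filter_upwards [ae_restrict_mem measurableSet_Icc] with x hx
    exact hC _ (mem_image_of_mem _ hx)
  have hsum := variance_sum_pi hmem
  have hX : MemLp (∑ i, fun ω : Fin p → ℝ ↦ f i (ω i)) 2 (Measure.pi ν) :=
    memLp_finsetSum' _ fun i _ => (hmem i).comp_measurePreserving (measurePreserving_eval _ i)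
  have hle : ∀ k, (1 / (u k - ℓ k)) * ⨅ w : ℝ, ∫ s in ℓ k..u k, |f k s - w| ^ 2 ≤
      Var[f k; ν k] := fun k => by
    have h0 : 0 < u k - ℓ k := sub_pos.2 (hlu k)
    rw [variance_eq_integral (hmem k).aestronglyMeasurable.aemeasurable]
    generalize (ν k)[f k] = c
    simp only [ν]
    rw [integral_smul_measure, ENNReal.toReal_inv, ENNReal.toReal_ofReal h0.le, smul_eq_mul,
      one_div, integral_Icc_eq_integral_Ioc, ← intervalIntegral.integral_of_le (hlu k).le]
    refine mul_le_mul_of_nonneg_left ?_ (inv_nonneg.2 h0.le)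
    have := ciInf_le (f := fun w : ℝ => ∫ s in ℓ k..u k, |f k s - w| ^ 2)
      ⟨0, by
        rintro _ ⟨w, rfl⟩
        exact intervalIntegral.integral_nonneg (hlu k).le fun s _ => by positivity⟩ c
    simpa only [sq_abs] using this
  refine (Finset.sum_le_sum fun k _ => hle k).trans ?_
  rw [← hsum, ← variance_sub_const hX.aestronglyMeasurable m]
  refine (variance_le_expectation_sq
    (hX.aestronglyMeasurable.sub aestronglyMeasurable_const)).trans ?_
  rw [hpi, integral_smul_measure, ENNReal.toReal_inv, smul_eq_mul]
  simp

lemma aux_q_mem {p : ℕ} (μ : Measure (Fin p → ℝ)) [IsFiniteMeasure μ] (A : Set (Fin p → ℝ))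
    (k : Fin p) (s : ℝ) : 0 ≤ condCDFCoord μ A k s ∧ condCDFCoord μ A k s ≤ 1 := by
  unfold condCDFCoord
  refine ⟨by positivity, div_le_one_of_le₀ ?_ ENNReal.toReal_nonneg⟩
  exact ENNReal.toReal_mono (measure_ne_top _ _) (measure_mono inter_subset_left)

lemma aux_q_meas {p : ℕ} (μ : Measure (Fin p → ℝ)) [IsFiniteMeasure μ] (A : Set (Fin p → ℝ))
    (k : Fin p) : Measurable (condCDFCoord μ A k) := by
  refine Monotone.measurable fun s t hst => ?_
  unfold condCDFCoord
  refine div_le_div_of_nonneg_right ?_ ENNReal.toReal_nonneg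
  refine ENNReal.toReal_mono (measure_ne_top _ _) (measure_mono ?_)
  exact inter_subset_inter_right _ fun v (hv : v k ≤ s) => show v k ≤ t from hv.trans hst

lemma aux_sup_nonneg {p : ℕ} (hp : 1 ≤ p) (μ : Measure (Fin p → ℝ)) (f : (Fin p → ℝ) → ℝ)
    (ℓ u : Fin p → ℝ) : 0 ≤ ⨆ j : Fin p, ⨆ b : ℝ, impurity μ f (rect ℓ u) j b := by
  refine le_trans (le_of_eq ?_) (aux_le_sup μ f (rect ℓ u) ⟨0, hp⟩ (u ⟨0, hp⟩))
  have h1 : cellL (rect ℓ u) ⟨0, hp⟩ (u ⟨0, hp⟩) = rect ℓ u :=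
    inter_eq_left.2 fun x hx => (hx ⟨0, hp⟩ (mem_univ _)).2
  have h2 : cellR (rect ℓ u) ⟨0, hp⟩ (u ⟨0, hp⟩) = ∅ := by
    ext x
    simp only [mem_empty_iff_false, iff_false]
    rintro ⟨hx, hx'⟩
    exact absurd (hx ⟨0, hp⟩ (mem_univ _)).2 (not_le.2 hx')
  simp [impurity, h1, h2]


/-- **Lemma (sufficient condition for SID via weighted reverse Poincaré inequalities).**
If for every nondegenerate closed rectangle `A = ∏[ℓ_k,u_k] ⊆ [0,1]^p` and every coordinate `k`,
`(∫ √(q(1-q)) |f_k'|)² ≤ (τ²/(u_k-ℓ_k)) inf_w ∫ |f_k - w|²`, then the SID condition holds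
with `λ = θlo/(p τ² θhi)`. -/
theorem sid_of_weighted_reverse_poincare
    (p : ℕ) (hp : 1 ≤ p)
    (μ : Measure (Fin p → ℝ)) [IsProbabilityMeasure μ]
    (pX : (Fin p → ℝ) → ℝ) (θlo θhi : ℝ)
    (hθlo : 0 < θlo) (hθlo1 : θlo ≤ 1) (hθhi1 : 1 ≤ θhi)
    (hdens : μ = (volume.restrict (box p)).withDensity fun u => ENNReal.ofReal (pX u))
    (hbound : ∀ u ∈ box p, θlo ≤ pX u ∧ pX u ≤ θhi)
    (f : Fin p → ℝ → ℝ) (f' : Fin p → ℝ → ℝ)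
    (hderiv : ∀ k, ∀ s ∈ Set.Icc (0 : ℝ) 1, HasDerivWithinAt (f k) (f' k s) (Set.Icc (0 : ℝ) 1) s)
    (hint : ∀ k, IntegrableOn (f' k) (Set.Icc (0 : ℝ) 1) volume)
    (fstar : (Fin p → ℝ) → ℝ)
    (hadd : ∀ u, fstar u = ∑ k, f k (u k))
    (τ : ℝ) (hτ : 0 < τ)
    (hyp : ∀ ℓ u : Fin p → ℝ, (∀ j, 0 ≤ ℓ j) → (∀ j, ℓ j < u j) → (∀ j, u j ≤ 1) →
      ∀ k : Fin p,
        (∫ s in ℓ k..u k,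
            Real.sqrt (condCDFCoord μ (rect ℓ u) k s * (1 - condCDFCoord μ (rect ℓ u) k s)) *
              |f' k s|) ^ 2
          ≤ τ ^ 2 / (u k - ℓ k) * ⨅ w : ℝ, ∫ s in ℓ k..u k, |f k s - w| ^ 2) :
    ∀ ℓ u : Fin p → ℝ, (∀ j, 0 ≤ ℓ j) → (∀ j, ℓ j ≤ u j) → (∀ j, u j ≤ 1) →
      (⨆ j : Fin p, ⨆ b : ℝ, impurity μ fstar (rect ℓ u) j b) ≥
        θlo / (p * τ ^ 2 * θhi) * (μ (rect ℓ u)).toReal * condVar μ fstar (rect ℓ u) := by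
  intro ℓ u h0 hlu h1
  set A := rect ℓ u with hAdef
  set M := ⨆ j : Fin p, ⨆ b : ℝ, impurity μ fstar A j b with hMdef
  have hM : 0 ≤ M := aux_sup_nonneg hp μ fstar ℓ u
  have hA : MeasurableSet A := aux_rect_meas ℓ u
  have hAc : IsCompact A := aux_rect_compact ℓ u
  have hAb : A ⊆ box p := fun x hx j _ =>
    ⟨(h0 j).trans (hx j (mem_univ j)).1, (hx j (mem_univ j)).2.trans (h1 j)⟩
  obtain ⟨hlow, hupp⟩ := aux_dens pX θlo θhi μ hdens hbound A hA hAb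
  have hθhi : 0 < θhi := by linarith
  have hvol : volume A = ∏ j, ENNReal.ofReal (u j - ℓ j) := by
    rw [hAdef, rect, volume_pi_pi]; simp
  have hvolr : (volume A).toReal = ∏ j, (u j - ℓ j) := by
    rw [hvol, ENNReal.toReal_prod]
    exact Finset.prod_congr rfl fun j _ => ENNReal.toReal_ofReal (sub_nonneg.2 (hlu j))
  have hvtop : volume A ≠ ∞ := hAc.measure_lt_top.ne
  have hPlow : θlo * (volume A).toReal ≤ (μ A).toReal := by
    have := hlow univ
    simp only [Measure.smul_apply, Measure.restrict_apply_univ, smul_eq_mul] at this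
    have := ENNReal.toReal_mono (measure_ne_top _ _) this
    rwa [ENNReal.toReal_mul, ENNReal.toReal_ofReal hθlo.le] at this
  have hPupp : (μ A).toReal ≤ θhi * (volume A).toReal := by
    have := hupp univ
    simp only [Measure.smul_apply, Measure.restrict_apply_univ, smul_eq_mul] at this
    have := ENNReal.toReal_mono (ENNReal.mul_ne_top ENNReal.ofReal_ne_top hvtop) this
    rwa [ENNReal.toReal_mul, ENNReal.toReal_ofReal hθhi.le] at this
  by_cases hdeg : ∀ j, ℓ j < u j
  swap
  · push Not at hdeg
    obtain ⟨j, hj⟩ := hdeg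
    have hv0 : (volume A).toReal = 0 := by
      rw [hvolr]
      exact Finset.prod_eq_zero (Finset.mem_univ j) (by linarith [hlu j])
    have hP0 : (μ A).toReal = 0 := by
      rw [hv0, mul_zero] at hPupp
      exact le_antisymm hPupp ENNReal.toReal_nonneg
    rw [hP0]
    simpa using hM
  have hvpos : 0 < (volume A).toReal := by
    rw [hvolr]; exact Finset.prod_pos fun j _ => sub_pos.2 (hdeg j)
  have hP : 0 < (μ A).toReal := lt_of_lt_of_le (by positivity) hPlow
  have hsubk : ∀ k, Icc (ℓ k) (u k) ⊆ Icc (0 : ℝ) 1 := fun k => Icc_subset_Icc (h0 k) (h1 k)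
  have hfc : ∀ k, ContinuousOn (f k) (Icc (ℓ k) (u k)) := fun k =>
    ContinuousOn.mono (fun s hs => (hderiv k s hs).continuousWithinAt) (hsubk k)
  have hfi : ∀ k, IntegrableOn (f' k) (Icc (ℓ k) (u k)) volume := fun k =>
    (hint k).mono_set (hsubk k)
  have hfd : ∀ k, ∀ s ∈ Ioo (ℓ k) (u k), HasDerivAt (f k) (f' k s) s := fun k s hs =>
    (hderiv k s (hsubk k ⟨hs.1.le, hs.2.le⟩)).hasDerivAt
      (Icc_mem_nhds (lt_of_le_of_lt (h0 k) hs.1) (lt_of_lt_of_le hs.2 (h1 k)))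
  have hfA : ∀ k, ContinuousOn (fun x : Fin p → ℝ => f k (x k)) A := fun k =>
    (hfc k).comp (continuous_apply k).continuousOn fun x hx => hx k (mem_univ k)
  have hstar : fstar = fun x => ∑ k, f k (x k) := funext hadd
  have hsc : ContinuousOn fstar A := by
    rw [hstar]; exact continuousOn_finsetSum _ fun k _ => hfA k
  have hs1 : IntegrableOn fstar A μ := hsc.integrableOn_compact hAc
  have hs2 : IntegrableOn (fun x => fstar x ^ 2) A μ := (hsc.pow 2).integrableOn_compact hAc
  set m := condMean μ fstar A with hm
  set V := ∫ x in A, (fstar x - m) ^ 2 ∂μ with hV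
  have hVP : (μ A).toReal * condVar μ fstar A = V := by
    unfold condVar; rw [← hm, ← hV]; field_simp
  have hV0 : 0 ≤ V := integral_nonneg fun x => sq_nonneg _
  have hFc : ContinuousOn (fun x => fstar x - m) A := hsc.sub continuousOn_const
  have hF0 : ∫ x in A, (fstar x - m) ∂μ = 0 := by
    rw [aux_lin μ fstar A hs1, hm, condMean]; field_simp; ring
  set S : Fin p → ℝ := fun k => ∫ s in ℓ k..u k,
    Real.sqrt (condCDFCoord μ A k s * (1 - condCDFCoord μ A k s)) * |f' k s| with hS
  have hVsum : V = ∑ k, ∫ x in A, (fstar x - m) * f k (x k) ∂μ := by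
    have hi : ∀ k ∈ Finset.univ, Integrable (fun x => (fstar x - m) * f k (x k))
        (μ.restrict A) := fun k _ => (hFc.mul (hfA k)).integrableOn_compact hAc
    rw [← integral_finsetSum _ hi]
    have e : ∀ x, (fstar x - m) ^ 2 =
        (∑ k, (fstar x - m) * f k (x k)) - m * (fstar x - m) := by
      intro x
      rw [← Finset.mul_sum, ← hadd x]; ring
    rw [hV]
    simp_rw [e]
    rw [integral_sub (f := fun x => ∑ k, (fstar x - m) * f k (x k)) _
      ((hFc.integrableOn_compact hAc).const_mul _), integral_const_mul, hF0]
    · ring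
    · exact (continuousOn_finsetSum _ fun k _ => hFc.mul (hfA k)).integrableOn_compact hAc
  have hk : ∀ k, (∫ x in A, (fstar x - m) * f k (x k) ∂μ) ≤
      Real.sqrt (M * (μ A).toReal) * S k := by
    intro k
    rw [hAdef, aux_fub μ ℓ u _ hFc hF0 k (f k) (f' k) (hfc k) (hfd k) (hfi k), ← hAdef]
    refine (neg_le_abs _).trans ?_
    rw [hS]
    simp only
    rw [intervalIntegral.integral_of_le (hlu k), ← integral_Icc_eq_integral_Ioc,
      ← integral_const_mul]
    rw [← Real.norm_eq_abs]
    have hqm := aux_q_meas μ A k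
    refine norm_integral_le_of_norm_le ?_ (Eventually.of_forall fun t => ?_)
    · refine Integrable.const_mul ?_ _
      refine Integrable.bdd_mul (c := 1) (hfi k).abs ?_ (Eventually.of_forall fun t => ?_)
      · exact (Real.continuous_sqrt.measurable.comp
          (hqm.mul (measurable_const.sub hqm))).aestronglyMeasurable
      · obtain ⟨a, b⟩ := aux_q_mem μ A k t
        rw [Real.norm_eq_abs, abs_of_nonneg (Real.sqrt_nonneg _)]
        refine Real.sqrt_le_one.2 ?_
        nlinarith
    · obtain ⟨a, b⟩ := aux_q_mem μ A k t
      rw [Real.norm_eq_abs, abs_mul, mul_comm, ← mul_assoc]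
      refine mul_le_mul_of_nonneg_right ?_ (abs_nonneg _)
      rw [← Real.sqrt_mul (by positivity)]
      refine Real.abs_le_sqrt ?_
      rw [aux_G μ fstar A hA hP hs1 hs2 k t]
      refine mul_le_mul_of_nonneg_right ?_ (mul_nonneg a (by linarith))
      exact mul_le_mul_of_nonneg_right (aux_le_sup μ fstar A k t) hP.le
  have hV1 : V ≤ Real.sqrt (M * (μ A).toReal) * ∑ k, S k := by
    rw [hVsum, Finset.mul_sum]; exact Finset.sum_le_sum fun k _ => hk k
  have hV2 : V ^ 2 ≤ M * (μ A).toReal * (∑ k, S k) ^ 2 := by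
    refine (pow_le_pow_left₀ hV0 hV1 2).trans (le_of_eq ?_)
    rw [mul_pow, Real.sq_sqrt (by positivity)]
  have hCS : (∑ k, S k) ^ 2 ≤ p * ∑ k, S k ^ 2 := by
    have := sq_sum_le_card_mul_sum_sq (s := (Finset.univ : Finset (Fin p))) (f := S)
    simpa using this
  have hSk : ∑ k, S k ^ 2 ≤
      τ ^ 2 * ∑ k, (1 / (u k - ℓ k)) * ⨅ w : ℝ, ∫ s in ℓ k..u k, |f k s - w| ^ 2 := by
    rw [Finset.mul_sum]
    refine Finset.sum_le_sum fun k _ => (hyp ℓ u h0 hdeg h1 k).trans (le_of_eq ?_)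
    ring
  have hU := aux_unif ℓ u hdeg f hfc m
  have hI : θlo * ∫ x in A, (∑ k, f k (x k) - m) ^ 2 ≤ V := by
    have h2 := integral_mono_measure (f := fun x => (fstar x - m) ^ 2) hlow
      (Eventually.of_forall fun x => sq_nonneg _) (aux_int_sq μ fstar A hs1 hs2 m)
    rw [integral_smul_measure, ENNReal.toReal_ofReal hθlo.le, smul_eq_mul] at h2
    simp_rw [hadd] at h2
    simpa [hV, hadd] using h2
  rw [ge_iff_le, mul_assoc, hVP]
  rcases hV0.eq_or_lt with hVz | hVpos
  · rw [← hVz, mul_zero]; exact hM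
  set J := ∫ x in A, (∑ k, f k (x k) - m) ^ 2 with hJ
  have hp0 : (0 : ℝ) < p := by exact_mod_cast hp
  have hJ' : J ≤ V / θlo := by rw [le_div_iff₀ hθlo]; linarith
  have c1 : V ^ 2 ≤ M * (μ A).toReal * (p * (τ ^ 2 * ((volume A).toReal⁻¹ * (V / θlo)))) := by
    refine hV2.trans (mul_le_mul_of_nonneg_left ?_ (by positivity))
    refine hCS.trans (mul_le_mul_of_nonneg_left ?_ hp0.le)
    refine hSk.trans (mul_le_mul_of_nonneg_left ?_ (by positivity))
    exact hU.trans (mul_le_mul_of_nonneg_left hJ' (by positivity))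
  have c2 : V ^ 2 ≤ M * (θhi * (volume A).toReal) *
      (p * (τ ^ 2 * ((volume A).toReal⁻¹ * (V / θlo)))) :=
    c1.trans (mul_le_mul_of_nonneg_right (mul_le_mul_of_nonneg_left hPupp hM) (by positivity))
  have c3 : M * (θhi * (volume A).toReal) *
      (p * (τ ^ 2 * ((volume A).toReal⁻¹ * (V / θlo)))) =
      (M * (p * τ ^ 2 * θhi) / θlo) * V := by
    field_simp
  rw [c3, sq] at c2
  have c4 := le_of_mul_le_mul_right c2 hVpos
  rw [le_div_iff₀ hθlo] at c4
  rw [div_mul_eq_mul_div, div_le_iff₀ (by positivity)]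
  linarith
end
end

section
/- Let 0 < σ < L and let g be a differentiable function on [0,1] that is L-smooth and σ-strongly convex, i.e. (σ/2)(t−s)² ≤ g(t) − g(s) − g'(s)(t−s) ≤ (L/2)(t−s)² for all t, s ∈ [0,1]. Let [a,b] ⊆ [0,1] with a < b, and let w ∈ ℝ be a median of g on [a,b], meaning that the Lebesgue measure of {t ∈ [a,b] : g(t) ≥ w} and of {t ∈ [a,b] : g(t) < w} are both equal to (b−a)/2. Then ∫_a^b |g'(t)| dt ≤ (110 L/σ) · (b−a)^{−1} · ∫_a^b |g(t) − w| dt. -/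
open MeasureTheory Set Filter

noncomputable section

theorem four_piece (f : ℝ → ℝ) (a k C : ℝ) (hk : 0 < k)
    (hf : ContinuousOn f (Set.Icc a (a + 4 * k)))
    (hC : ∀ t ∈ Set.Icc a (a + k), C ≤ f t + f (t + k) + f (t + 2 * k) + f (t + 3 * k)) :
    C * k ≤ ∫ t in a..(a + 4 * k), f t := by
  have hI : ∀ x y : ℝ, a ≤ x → x ≤ y → y ≤ a + 4 * k → IntervalIntegrable f volume x y := by
    intro x y h1 h2 h3
    apply ContinuousOn.intervalIntegrable
    rw [Set.uIcc_of_le h2]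
    exact hf.mono (Set.Icc_subset_Icc h1 h3)
  have hS : ∀ c : ℝ, 0 ≤ c → c ≤ 3 * k →
      IntervalIntegrable (fun t => f (t + c)) volume a (a + k) := by
    intro c h0 h1
    apply ContinuousOn.intervalIntegrable
    rw [Set.uIcc_of_le (by linarith)]
    apply hf.comp (by fun_prop)
    intro t ht
    exact ⟨by linarith [ht.1], by linarith [ht.2]⟩
  have h0 := hI a (a + k) le_rfl (by linarith) (by linarith)
  have e1 : ∫ t in a..(a+k), f (t + k) = ∫ t in (a+k)..(a+2*k), f t := by
    rw [intervalIntegral.integral_comp_add_right]; congr 1; ring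
  have e2 : ∫ t in a..(a+k), f (t + 2*k) = ∫ t in (a+2*k)..(a+3*k), f t := by
    rw [intervalIntegral.integral_comp_add_right]; congr 1; ring
  have e3 : ∫ t in a..(a+k), f (t + 3*k) = ∫ t in (a+3*k)..(a+4*k), f t := by
    rw [intervalIntegral.integral_comp_add_right]; congr 1; ring
  have i1 := hS k hk.le (by linarith)
  have i2 := hS (2*k) (by linarith) (by linarith)
  have i3 := hS (3*k) (by linarith) (by linarith)
  have tot : ∫ t in a..(a + 4 * k), f t =
      ∫ t in a..(a+k), (f t + f (t + k) + f (t + 2 * k) + f (t + 3 * k)) := by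
    rw [intervalIntegral.integral_add ((h0.add i1).add i2) i3,
      intervalIntegral.integral_add (h0.add i1) i2, intervalIntegral.integral_add h0 i1, e1, e2, e3,
      intervalIntegral.integral_add_adjacent_intervals
        (hI _ _ le_rfl (by linarith) (by linarith)) (hI _ _ (by linarith) (by linarith) (by linarith)),
      intervalIntegral.integral_add_adjacent_intervals
        (hI _ _ le_rfl (by linarith) (by linarith)) (hI _ _ (by linarith) (by linarith) (by linarith)),
      intervalIntegral.integral_add_adjacent_intervals
        (hI _ _ le_rfl (by linarith) (by linarith)) (hI _ _ (by linarith) (by linarith) (by linarith))]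
  rw [tot]
  have := intervalIntegral.integral_mono_on (by linarith : a ≤ a + k)
    (intervalIntegrable_const (c := C)) (((h0.add i1).add i2).add i3) hC
  rw [intervalIntegral.integral_const] at this
  simp only [smul_eq_mul] at this
  calc C * k = (a + k - a) * C := by ring
    _ ≤ _ := this

/-- **Lemma (L¹ reverse Poincaré inequality around a median, for smooth strongly convex `g`).**
If `g` is differentiable on `[0,1]`, `L`-smooth and `σ`-strongly convex (`0 < σ < L`),
`[a,b] ⊆ [0,1]` with `a < b`, and `w` is a median of `g` on `[a,b]`
(i.e. `Leb{t ∈ [a,b] : g(t) ≥ w} = Leb{t ∈ [a,b] : g(t) < w} = (b−a)/2`), then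
`∫_a^b |g'| ≤ (110 L/σ) (b−a)⁻¹ ∫_a^b |g − w|`. -/
theorem l1_reverse_poincare_median (g g' : ℝ → ℝ) (σ L : ℝ) (hσ : 0 < σ) (hσL : σ < L)
    (hderiv : ∀ t ∈ Set.Icc (0 : ℝ) 1, HasDerivWithinAt g (g' t) (Set.Icc (0 : ℝ) 1) t)
    (hsc : ∀ t ∈ Set.Icc (0 : ℝ) 1, ∀ s ∈ Set.Icc (0 : ℝ) 1,
      σ / 2 * (t - s) ^ 2 ≤ g t - g s - g' s * (t - s))
    (hsm : ∀ t ∈ Set.Icc (0 : ℝ) 1, ∀ s ∈ Set.Icc (0 : ℝ) 1,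
      g t - g s - g' s * (t - s) ≤ L / 2 * (t - s) ^ 2)
    (a b : ℝ) (ha : 0 ≤ a) (hab : a < b) (hb : b ≤ 1)
    (w : ℝ)
    (hmed_ge : volume {t ∈ Set.Icc a b | w ≤ g t} = ENNReal.ofReal ((b - a) / 2))
    (hmed_lt : volume {t ∈ Set.Icc a b | g t < w} = ENNReal.ofReal ((b - a) / 2)) :
    (∫ t in a..b, |g' t|) ≤ 110 * L / σ * (b - a)⁻¹ * ∫ t in a..b, |g t - w| := by
  have hL : 0 < L := hσ.trans hσL
  obtain ⟨k, hk⟩ : ∃ k, k = (b - a) / 4 := ⟨_, rfl⟩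
  have hk0 : 0 < k := by rw [hk]; linarith
  obtain rfl : b = a + 4 * k := by rw [hk]; ring
  have hm : ∀ t ∈ Set.Icc a (a + 4 * k), t ∈ Set.Icc (0 : ℝ) 1 := fun t ht =>
    ⟨by linarith [ht.1], by linarith [ht.2]⟩
  have hcont : ContinuousOn (fun t => |g t - w|) (Set.Icc a (a + 4 * k)) := by
    have : ContinuousOn g (Set.Icc a (a + 4 * k)) := fun t ht =>
      ((hderiv t (hm t ht)).continuousWithinAt).mono hm
    fun_prop
  -- derivative bounds
  have hmono : ∀ s ∈ Set.Icc (0 : ℝ) 1, ∀ t ∈ Set.Icc (0 : ℝ) 1, s < t →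
      σ * (t - s) ≤ g' t - g' s := by
    intro s hs t ht hst
    have h1 := hsc t ht s hs
    have h2 := hsc s hs t ht
    have : 0 < t - s := by linarith
    refine le_of_mul_le_mul_right ?_ this
    nlinarith
  have hlip : ∀ s ∈ Set.Icc (0 : ℝ) 1, ∀ t ∈ Set.Icc (0 : ℝ) 1, s < t →
      g' t - g' s ≤ L * (t - s) := by
    intro s hs t ht hst
    have h1 := hsm t ht s hs
    have h2 := hsm s hs t ht
    have : 0 < t - s := by linarith
    refine le_of_mul_le_mul_right ?_ this
    nlinarith
  have haI : a ∈ Set.Icc a (a + 4 * k) := ⟨le_rfl, by linarith⟩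
  have hb1 : ∀ t ∈ Set.Icc a (a + 4 * k), g' a ≤ g' t ∧ g' t ≤ g' a + 4 * L * k := by
    intro t ht
    rcases ht.1.eq_or_lt with h | h
    · subst h; constructor
      · exact le_rfl
      · nlinarith
    · have h1 := hmono a (hm a haI) t (hm t ht) h
      have h2 := hlip a (hm a haI) t (hm t ht) h
      have h3 := ht.2
      constructor <;> nlinarith
  have hup : (∫ t in a..(a + 4 * k), |g' t|) ≤ (|g' a| + 4 * L * k) * (4 * k) := by
    have := intervalIntegral.norm_integral_le_of_norm_le_const (a := a) (b := a + 4 * k)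
      (f := fun t => |g' t|) (C := |g' a| + 4 * L * k) (by
        intro t ht
        rw [Set.uIoc_of_le (by linarith)] at ht
        obtain ⟨h1, h2⟩ := hb1 t ⟨ht.1.le, ht.2⟩
        have : 0 < L * k := by positivity
        rw [Real.norm_eq_abs, abs_abs]
        exact abs_le.2 ⟨by linarith [neg_abs_le (g' a)], by linarith [le_abs_self (g' a)]⟩)
    rw [show a + 4 * k - a = 4 * k by ring, abs_of_pos (by linarith : 0 < 4 * k)] at this
    exact (le_abs_self _).trans this
  have pts : ∀ t ∈ Set.Icc a (a + k), t ∈ Set.Icc a (a + 4 * k) ∧ t + k ∈ Set.Icc a (a + 4 * k) ∧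
      t + 2 * k ∈ Set.Icc a (a + 4 * k) ∧ t + 3 * k ∈ Set.Icc a (a + 4 * k) := by
    intro t ht
    obtain ⟨h1, h2⟩ := ht
    refine ⟨⟨?_, ?_⟩, ⟨?_, ?_⟩, ⟨?_, ?_⟩, ⟨?_, ?_⟩⟩ <;> linarith
  have low1 := four_piece (fun t => |g t - w|) a k (2 * σ * k ^ 2) hk0 hcont (by
    intro t ht
    obtain ⟨m0, m1, m2, m3⟩ := pts t ht
    have h1 := hsc t (hm _ m0) (t + k) (hm _ m1)
    have h2 := hsc (t + 3 * k) (hm _ m3) (t + 2 * k) (hm _ m2)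
    have h3 := hmono (t + k) (hm _ m1) (t + 2 * k) (hm _ m2) (by linarith)
    have h4 := mul_le_mul_of_nonneg_right h3 hk0.le
    have a0 := le_abs_self (g t - w)
    have a1 := neg_abs_le (g (t + k) - w)
    have a2 := neg_abs_le (g (t + 2 * k) - w)
    have a3 := le_abs_self (g (t + 3 * k) - w)
    ring_nf at *
    linarith)
  set I := ∫ t in a..(a + 4 * k), |g t - w| with hI
  have hgoal : ∀ J : ℝ, J * (4 * k) * σ ≤ 110 * L * I →
      J ≤ 110 * L / σ * (a + 4 * k - a)⁻¹ * I := by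
    intro J hJ
    rw [show 110 * L / σ * (a + 4 * k - a)⁻¹ * I = (110 * L * I) / (4 * k * σ) by
      rw [show a + 4 * k - a = 4 * k by ring]; field_simp]
    rw [le_div_iff₀ (by positivity)]
    linarith
  refine hup.trans (hgoal _ ?_)
  by_cases hc : |g' a| ≤ 8 * L * k
  · have h1 : (|g' a| + 4 * L * k) * (4 * k) * (4 * k) * σ ≤
        (8 * L * k + 4 * L * k) * (4 * k) * (4 * k) * σ := by gcongr
    have h2 := mul_le_mul_of_nonneg_left low1 hL.le
    have h3 : 0 < L * σ * k ^ 3 := by positivity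
    nlinarith
  · push Not at hc
    have low2 := four_piece (fun t => |g t - w|) a k (2 * |g' a| * k) hk0 hcont (by
      intro t ht
      obtain ⟨m0, m1, m2, m3⟩ := pts t ht
      have hq : 0 ≤ σ / 2 * (2 * k) ^ 2 := by positivity
      rcases le_total 0 (g' a) with h | h
      · rw [abs_of_nonneg h]
        have h1 := hsc (t + 2 * k) (hm _ m2) t (hm _ m0)
        have h2 := hsc (t + 3 * k) (hm _ m3) (t + k) (hm _ m1)
        have h3 := mul_le_mul_of_nonneg_right (hb1 _ m0).1 hk0.le
        have h4 := mul_le_mul_of_nonneg_right (hb1 _ m1).1 hk0.le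
        have h5 : 0 ≤ g' a * k := by positivity
        have a0 := neg_abs_le (g t - w)
        have a1 := neg_abs_le (g (t + k) - w)
        have a2 := le_abs_self (g (t + 2 * k) - w)
        have a3 := le_abs_self (g (t + 3 * k) - w)
        ring_nf at *
        linarith
      · rw [abs_of_nonpos h] at hc ⊢
        have h1 := hsc t (hm _ m0) (t + 2 * k) (hm _ m2)
        have h2 := hsc (t + k) (hm _ m1) (t + 3 * k) (hm _ m3)
        have h3 := mul_le_mul_of_nonneg_right (hb1 _ m2).2 hk0.le
        have h4 := mul_le_mul_of_nonneg_right (hb1 _ m3).2 hk0.le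
        have h5 := mul_le_mul_of_nonneg_right hc.le hk0.le
        have a0 := le_abs_self (g t - w)
        have a1 := le_abs_self (g (t + k) - w)
        have a2 := neg_abs_le (g (t + 2 * k) - w)
        have a3 := neg_abs_le (g (t + 3 * k) - w)
        ring_nf at *
        linarith)
    rw [← hI] at low2
    have hI0 : 0 ≤ I := le_trans (by positivity) low2
    have h1 : (|g' a| + 4 * L * k) * (4 * k) * (4 * k) ≤ 12 * I := by
      nlinarith [mul_le_mul_of_nonneg_right hc.le (sq_nonneg k)]
    have h2 := mul_le_mul_of_nonneg_right h1 hσ.le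
    nlinarith [mul_le_mul_of_nonneg_right hσL.le hI0, mul_nonneg hL.le hI0]
end
end
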